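/- arXiv:2407.15785 — 3 statements merged into one kernel-verified Lean document; each statement's English description precedes it below -/
import Mathlib

section
/- Let m, k be positive integers. Any subset S of size k of the dicyclic group Dic_m not containing the identity is sequenceable provided that every prime factor of m is greater than k^k. -/
/-- A finite subset `S` of a group is *sequenceable* if there is an ordering
`(x₁, …, x_k)` of its elements such that the partial products `s₀ = 1`,
`s_i = x₁ ⋯ x_i` are pairwise distinct, with the possible exception that
`s_k = s₀` is allowed. -/
def IsSequenceable {G : Type*} [Group G] (S : Finset G) : Prop :=
  ∃ l : List G, l.Nodup ∧ (∀ x, x ∈ l ↔ x ∈ S) ∧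
    ∀ i j : ℕ, i < j → j ≤ l.length → ¬(i = 0 ∧ j = l.length) →
      (l.take i).prod ≠ (l.take j).prod

namespace InfiniteDicyclic

/-- The sign by which an element of `ZMod 4` acts on `ℤ`. -/
def sgn (v : ZMod 4) : ℤ := if v = 0 ∨ v = 2 then 1 else -1

theorem sgn_add : ∀ v u : ZMod 4, sgn (v + u) = sgn v * sgn u := by decide

theorem sgn_eq_or (v : ZMod 4) : sgn v = 1 ∨ sgn v = -1 := by
  unfold sgn; split_ifs <;> simp

/-- The product of `s` and `x` in the semidirect product `ℤ ⋊ ZMod 4`. -/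
def step (s x : ℤ × ZMod 4) : ℤ × ZMod 4 := (s.1 + sgn s.2 * x.1, s.2 + x.2)

/-- The partial products of `l` in `ℤ ⋊ ZMod 4` are distinct, except that the last one may be
the identity. -/
def DistinctProducts (l : List (ℤ × ZMod 4)) : Prop :=
  ∀ i j : ℕ, i < j → j ≤ l.length → ¬(i = 0 ∧ j = l.length) →
    (l.take i).foldl step 0 ≠ (l.take j).foldl step 0

/-- `S` has an ordering with distinct partial products in `ℤ ⋊ ZMod 4`. -/
def HasOrdering (S : Finset (ℤ × ZMod 4)) : Prop :=
  ∃ l : List (ℤ × ZMod 4), l.Nodup ∧ (∀ x, x ∈ l ↔ x ∈ S) ∧ DistinctProducts l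

theorem foldl_take_ne_of_nodup_scanl {l : List (ℤ × ZMod 4)} {s : ℤ × ZMod 4}
    (h : (l.scanl step s).Nodup) {i j : ℕ} (hij : i < j) (hj : j ≤ l.length) :
    (l.take i).foldl step s ≠ (l.take j).foldl step s := by
  have hi' : i < (l.scanl step s).length := by simp; omega
  have hj' : j < (l.scanl step s).length := by simp; omega
  rw [← List.getElem_scanl hi', ← List.getElem_scanl hj']
  intro he
  have := (h.getElem_inj_iff).1 he
  omega

theorem DistinctProducts.of_nodup {l : List (ℤ × ZMod 4)} (h : (l.scanl step 0).Nodup) :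
    DistinctProducts l :=
  fun _ _ hij hj _ => foldl_take_ne_of_nodup_scanl h hij hj

theorem DistinctProducts.of_closed {x y : ℤ × ZMod 4} {l : List (ℤ × ZMod 4)}
    (h : (l.scanl step (step 0 x)).Nodup) (h0 : 0 ∉ l.scanl step (step 0 x))
    (hy : ((x :: l) ++ [y]).foldl step 0 = 0) :
    DistinctProducts ((x :: l) ++ [y]) := by
  intro i j hij hj hne
  have mem (i : ℕ) (hi : i ≤ l.length) :
      (l.take i).foldl step (step 0 x) ∈ l.scanl step (step 0 x) := by
    have hi' : i < (l.scanl step (step 0 x)).length := by simp; omega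
    rw [← List.getElem_scanl hi']
    exact List.getElem_mem _
  obtain ⟨j, rfl⟩ : ∃ j', j = j' + 1 := ⟨j - 1, by omega⟩
  simp only [List.length_append, List.length_cons, List.length_nil] at hj hne
  have tk (t : ℕ) (ht : t ≤ l.length) :
      (((x :: l) ++ [y]).take (t + 1)).foldl step 0 = (l.take t).foldl step (step 0 x) := by
    rw [List.take_append_of_le_length (by simpa using ht)]; simp
  have notz (t : ℕ) (ht : t ≤ l.length) :
      (((x :: l) ++ [y]).take (t + 1)).foldl step 0 ≠ 0 := by
    rw [tk t ht]
    intro h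
    have := mem t ht
    rw [h] at this
    exact h0 this
  rcases i with _ | i
  · exact fun h => notz j (by omega) h.symm
  · by_cases hjl : j = l.length + 1
    · rw [List.take_of_length_le (i := j + 1) (by simp; omega), hy]
      exact notz i (by omega)
    · rw [tk i (by omega), tk j (by omega)]
      exact foldl_take_ne_of_nodup_scanl h (by omega) (by omega)

/-- The reflection `(a, v) ↦ (-a, v)`. -/
def mirror (x : ℤ × ZMod 4) : ℤ × ZMod 4 := (-x.1, x.2)

theorem mirror_mirror (x : ℤ × ZMod 4) : mirror (mirror x) = x := by simp [mirror]

theorem mirror_injective : Function.Injective mirror :=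
  Function.LeftInverse.injective mirror_mirror

theorem foldl_map_mirror (l : List (ℤ × ZMod 4)) (s : ℤ × ZMod 4) :
    (l.map mirror).foldl step (mirror s) = mirror (l.foldl step s) := by
  induction l generalizing s with
  | nil => rfl
  | cons x l ih =>
    have : step (mirror s) (mirror x) = mirror (step s x) := by
      simp only [step, mirror, Prod.mk.injEq, and_true]; ring
    simp [this, ih]

theorem HasOrdering.of_mirror {S : Finset (ℤ × ZMod 4)} (h : HasOrdering (S.image mirror)) :
    HasOrdering S := by
  obtain ⟨l, hnd, hmem, hd⟩ := h
  refine ⟨l.map mirror, hnd.map mirror_injective, fun x => ?_, fun i j hij hj hne he => ?_⟩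
  · rw [← mirror_injective.mem_finset_image, ← hmem, List.mem_map]
    exact ⟨by rintro ⟨y, hy, rfl⟩; rwa [mirror_mirror], fun h => ⟨_, h, mirror_mirror x⟩⟩
  · simp only [List.length_map] at hj hne
    refine hd i j hij hj hne (mirror_injective ?_)
    have h0 : mirror 0 = 0 := by simp [mirror]
    rwa [← foldl_map_mirror, ← foldl_map_mirror, h0, List.map_take, List.map_take]

/-- The path from `s` along `l` strictly climbs on each of the two classes of states with equal
sign, where `q` is the height to be exceeded by the class not containing `s`. -/
def Climbs : ℤ × ZMod 4 → ℤ → List (ℤ × ZMod 4) → Prop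
  | _, _, [] => True
  | s, q, x :: l =>
    if sgn x.2 = 1 then s.1 < (step s x).1 ∧ Climbs (step s x) q l
    else q < (step s x).1 ∧ Climbs (step s x) s.1 l

theorem Climbs.mem_scanl {s : ℤ × ZMod 4} {q : ℤ} {l : List (ℤ × ZMod 4)} (h : Climbs s q l) :
    ∀ t ∈ l.scanl step s,
      t = s ∨ (sgn t.2 = sgn s.2 ∧ s.1 < t.1) ∨ (sgn t.2 ≠ sgn s.2 ∧ q < t.1) := by
  induction l generalizing s q with
  | nil => simp
  | cons x l ih =>
    intro t ht
    rw [List.scanl_cons, List.mem_cons] at ht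
    rcases ht with rfl | ht
    · exact Or.inl rfl
    have hs : sgn (step s x).2 = sgn s.2 * sgn x.2 := sgn_add _ _
    rw [Climbs] at h
    split_ifs at h with hx
    · rcases ih h.2 t ht with rfl | h' | h' <;> grind
    · have hx' := (sgn_eq_or x.2).resolve_left hx
      have h1 := sgn_eq_or s.2
      have h2 := sgn_eq_or t.2
      rcases ih h.2 t ht with rfl | h' | h' <;> grind

theorem Climbs.nodup_scanl {s : ℤ × ZMod 4} {q : ℤ} {l : List (ℤ × ZMod 4)} (h : Climbs s q l) :
    (l.scanl step s).Nodup := by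
  induction l generalizing s q with
  | nil => simp
  | cons x l ih =>
    have hs : sgn (step s x).2 = sgn s.2 * sgn x.2 := sgn_add _ _
    rw [Climbs] at h
    rw [List.scanl_cons, List.nodup_cons]
    split_ifs at h with hx
    · refine ⟨fun hm => ?_, ih h.2⟩
      have := h.2.mem_scanl s hm
      grind
    · refine ⟨fun hm => ?_, ih h.2⟩
      have := h.2.mem_scanl s hm
      have hx' := (sgn_eq_or x.2).resolve_left hx
      have h1 := sgn_eq_or s.2
      grind

theorem Climbs.append {s : ℤ × ZMod 4} {q : ℤ} {l p : List (ℤ × ZMod 4)}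
    (hp : ∀ x ∈ p, sgn x.2 = 1 ∧ 0 < sgn s.2 * x.1)
    (hl : ∀ s' : ℤ × ZMod 4, sgn s'.2 = sgn s.2 → s.1 ≤ s'.1 → Climbs s' q l) :
    Climbs s q (p ++ l) := by
  induction p generalizing s with
  | nil => exact hl s rfl le_rfl
  | cons x p ih =>
    have hx := hp x (by simp)
    have hs : sgn (step s x).2 = sgn s.2 := by simp [step, sgn_add, hx.1]
    have hlt : s.1 < (step s x).1 := by simp only [step]; linarith [hx.2]
    rw [List.cons_append, Climbs, if_pos hx.1]
    refine ⟨hlt, ih (fun y hy => ?_) fun s' h1 h2 => hl s' (h1.trans hs) (hlt.le.trans h2)⟩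
    rw [hs]; exact hp y (by simp [hy])

/-- Consecutive values of `f` along the list alternately fall and rise, starting with a fall if
`σ = 1` and with a rise if `σ = -1`. -/
def Zigzag {α : Type*} (f : α → ℤ) : ℤ → List α → Prop
  | σ, x :: y :: l => 0 < σ * (f x - f y) ∧ Zigzag f (-σ) (y :: l)
  | _, _ => True

theorem Zigzag.climbs {b : ℤ × ZMod 4} {l : List (ℤ × ZMod 4)} {s : ℤ × ZMod 4} {q : ℤ}
    (hz : Zigzag Prod.fst (-sgn s.2) (b :: l)) (hl : ∀ x ∈ l, sgn x.2 = -1)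
    (hs : q - sgn s.2 * b.1 ≤ s.1) : Climbs s q l := by
  induction l generalizing b s q with
  | nil => trivial
  | cons x l ih =>
    have hx := hl x (by simp)
    have hsx : sgn (step s x).2 = -sgn s.2 := by simp [step, sgn_add, hx]
    obtain ⟨h1, h2⟩ := hz
    rw [Climbs, if_neg (by rw [hx]; decide)]
    refine ⟨by simp only [step]; linarith, ih (by rwa [hsx]) (fun y hy => hl y (by simp [hy])) ?_⟩
    rw [hsx]; simp only [step]; linarith

/-- A finite set on which no three elements share the same value of `f` can be ordered with
zigzagging values, unless it is a pair with a common value. -/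
theorem exists_zigzag {α : Type*} [DecidableEq α] (f : α → ℤ) (n : ℕ) :
    ∀ R : Finset α, R.card = n + 1 →
    (∀ x ∈ R, ∀ y ∈ R, ∀ z ∈ R, x ≠ y → y ≠ z → x ≠ z → f x = f y → f y ≠ f z) →
    (∃ x y, x ≠ y ∧ R = {x, y} ∧ f x = f y) ∨
    ∃ (σ : ℤ) (l : List α), (σ = 1 ∨ σ = -1) ∧ l.Nodup ∧ (∀ x, x ∈ l ↔ x ∈ R) ∧ Zigzag f σ l := by
  induction n using Nat.strong_induction_on with
  | _ n ih =>
  intro R hR h3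
  obtain ⟨M, hM, hmax⟩ := R.exists_max_image f (Finset.card_pos.1 (by omega))
  have hR1 : (R.erase M).card = n := by rw [Finset.card_erase_of_mem hM]; omega
  have memR₁ (x : α) : x ∈ R ↔ x = M ∨ x ∈ R.erase M := by grind
  rcases n with _ | n
  · rw [Finset.card_eq_zero] at hR1
    exact Or.inr ⟨1, [M], Or.inl rfl, by simp, by simp [memR₁, hR1], trivial⟩
  obtain ⟨m, hm, hmin⟩ := (R.erase M).exists_min_image f (Finset.card_pos.1 (by omega))
  have hR2 : ((R.erase M).erase m).card = n := by rw [Finset.card_erase_of_mem hm]; omega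
  have memR (x : α) : x ∈ R ↔ x = M ∨ x = m ∨ x ∈ (R.erase M).erase m := by grind
  have hsub (x : α) (hx : x ∈ (R.erase M).erase m) :
      x ∈ R ∧ x ≠ M ∧ x ≠ m ∧ f m ≤ f x ∧ f x ≤ f M := by grind
  have hmR : m ∈ R ∧ m ≠ M ∧ f m ≤ f M := by grind
  clear hm hmin hR1 memR₁
  generalize (R.erase M).erase m = R' at hR2 memR hsub
  rcases n with _ | n
  · obtain rfl := Finset.card_eq_zero.1 hR2
    by_cases hfm : f M = f m
    · exact Or.inl ⟨M, m, hmR.2.1.symm, by ext x; simp [memR], hfm⟩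
    · refine Or.inr ⟨1, [M, m], Or.inl rfl, by grind, by simp [memR], ?_⟩
      simp only [Zigzag, and_true]
      grind
  rcases n with _ | n
  · obtain ⟨x, rfl⟩ := Finset.card_eq_one.1 hR2
    have hx := hsub x (by simp)
    by_cases hmx : f m = f x
    · refine Or.inr ⟨-1, [m, M, x], Or.inr rfl, by grind, by grind, ?_⟩
      simp only [Zigzag]
      grind
    · refine Or.inr ⟨1, [M, m, x], Or.inl rfl, by grind, by grind, ?_⟩
      simp only [Zigzag]
      grind
  rcases ih (n + 1) (by omega) R' hR2 (by grind) with
    ⟨y, y', hyy, rfl, hf⟩ | ⟨σ, l, hσ, hnd, hmem, hz⟩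
  · refine Or.inr ⟨1, [y, m, M, y'], Or.inl rfl, by grind, by grind, ?_⟩
    simp only [Zigzag]
    have h1 := hsub y (by simp)
    have h2 := hsub y' (by simp)
    have h4 := h3 m hmR.1 y h1.1 y' h2.1
    have h5 := h3 M hM y h1.1 y' h2.1
    grind
  · match l, hnd, hmem, hz with
    | [], _, hmem, _ =>
      have : R' = ∅ := by ext x; simp [← hmem]
      simp [this] at hR2
    | [x], _, hmem, _ =>
      have : R' = {x} := by ext x; simp [← hmem]
      simp [this] at hR2
    | x :: y :: l, hnd, hmem, hz =>
      have h1 := hsub x ((hmem x).1 (by simp))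
      have h2 := hsub y ((hmem y).1 (by simp))
      have hz1 := hz.1
      rcases hσ with rfl | rfl
      · refine Or.inr ⟨1, M :: m :: x :: y :: l, Or.inl rfl, by grind, by grind, ?_⟩
        refine ⟨by grind, by grind, ?_⟩
        simpa using hz
      · refine Or.inr ⟨-1, m :: M :: x :: y :: l, Or.inr rfl, by grind, by grind, ?_⟩
        refine ⟨by grind, by grind, ?_⟩
        simpa using hz

theorem eq_of_fst_eq_zero {x : ℤ × ZMod 4} (hx : x ≠ 0) (hs : sgn x.2 = 1) (h : x.1 = 0) :
    x = (0, 2) := by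
  obtain ⟨a, v⟩ := x
  have : ∀ v : ZMod 4, sgn v = 1 → v = 0 ∨ v = 2 := by decide
  rcases this v hs with rfl | rfl
  · exact absurd (Prod.ext h rfl : ((a, 0) : ℤ × ZMod 4) = 0) hx
  · exact Prod.ext h rfl

theorem HasOrdering.of_climbs {S : Finset (ℤ × ZMod 4)} (h0 : (0 : ℤ × ZMod 4) ∉ S)
    {b : ℤ × ZMod 4} {l : List (ℤ × ZMod 4)} (hnd : (b :: l).Nodup)
    (hmem : ∀ x, x ∈ b :: l ↔ x ∈ S ∧ ¬(sgn x.2 = 1 ∧ 0 ≤ x.1)) (hb : sgn b.2 = -1)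
    (hl : ∀ s : ℤ × ZMod 4, sgn s.2 = 1 → Climbs (step s b) s.1 l) : HasOrdering S := by
  set p := (S.filter fun x => sgn x.2 = 1 ∧ 0 < x.1).toList with hp
  have hpm (x) : x ∈ p ↔ x ∈ S ∧ sgn x.2 = 1 ∧ 0 < x.1 := by simp [hp]
  have hpnd : (p ++ b :: l).Nodup := by
    refine List.nodup_append'.2 ⟨Finset.nodup_toList _, hnd, fun x hx hx' => ?_⟩
    have := (hpm x).1 hx
    have := (hmem x).1 hx'
    grind
  have hcl (s : ℤ × ZMod 4) (hs : sgn s.2 = 1) (hs0 : s.1 = 0) :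
      Climbs s (b.1 - 1) (p ++ b :: l) := by
    refine Climbs.append (fun x hx => ?_) fun s' h1 h2 => ?_
    · have := (hpm x).1 hx
      exact ⟨this.2.1, by rw [hs]; linarith [this.2.2]⟩
    · rw [hs] at h1
      rw [Climbs, if_neg (by rw [hb]; decide)]
      refine ⟨?_, hl s' h1⟩
      simp only [step, h1]
      linarith
  by_cases hc : ((0, 2) : ℤ × ZMod 4) ∈ S
  · have hcp : ((0, 2) : ℤ × ZMod 4) ∉ p ++ b :: l := by
      have h1 := hpm (0, 2)
      have h2 := hmem (0, 2)
      have h3 : sgn 2 = 1 := by decide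
      simp only [h3] at h1 h2
      rw [List.mem_append, h1, h2]
      simp
    refine ⟨(0, 2) :: (p ++ b :: l), List.nodup_cons.2 ⟨hcp, hpnd⟩, fun x => ?_, .of_nodup ?_⟩
    · rw [List.mem_cons, List.mem_append, hpm, hmem]
      constructor
      · rintro (rfl | h | h)
        exacts [hc, h.1, h.1]
      · intro hx
        have := @eq_of_fst_eq_zero x (fun h => h0 (h ▸ hx))
        grind
    · have h2 : step 0 (0, 2) = (0, 2) := by decide
      have hcl' := hcl (0, 2) (by decide) rfl
      rw [List.scanl_cons, h2, List.nodup_cons]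
      refine ⟨fun h => ?_, hcl'.nodup_scanl⟩
      rcases hcl'.mem_scanl 0 h with h | h | h
      · exact absurd h (by decide)
      · exact lt_irrefl _ h.2
      · exact h.1 (by decide)
  · refine ⟨p ++ b :: l, hpnd, fun x => ?_, .of_nodup (hcl 0 (by decide) rfl).nodup_scanl⟩
    rw [List.mem_append, hpm, hmem]
    constructor
    · rintro (h | h)
      exacts [h.1, h.1]
    · intro hx
      have := @eq_of_fst_eq_zero x (fun h => h0 (h ▸ hx))
      grind

/-- The list of elements of `S` which are translations in the negative direction. -/
noncomputable def negatives (S : Finset (ℤ × ZMod 4)) : List (ℤ × ZMod 4) :=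
  (S.filter fun x => sgn x.2 = 1 ∧ x.1 < 0).toList

theorem mem_negatives {S : Finset (ℤ × ZMod 4)} {x : ℤ × ZMod 4} :
    x ∈ negatives S ↔ x ∈ S ∧ sgn x.2 = 1 ∧ x.1 < 0 := by simp [negatives]

theorem HasOrdering.of_negatives {S : Finset (ℤ × ZMod 4)} (h0 : (0 : ℤ × ZMod 4) ∉ S)
    {b : ℤ × ZMod 4} {l : List (ℤ × ZMod 4)} (hnd : (b :: l).Nodup)
    (hmem : ∀ x, x ∈ b :: l ↔ x ∈ S ∧ sgn x.2 = -1)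
    (hl : ∀ s : ℤ × ZMod 4, sgn s.2 = 1 → Climbs (step s b) s.1 (negatives S ++ l)) :
    HasOrdering S := by
  have hb := ((hmem b).1 (by simp)).2
  have hperm : (b :: (negatives S ++ l)).Perm (negatives S ++ b :: l) := List.perm_middle.symm
  refine HasOrdering.of_climbs h0 (hperm.nodup_iff.2 ?_) (fun x => ?_) hb hl
  · refine List.nodup_append'.2 ⟨Finset.nodup_toList _, hnd, fun x hx hx' => ?_⟩
    have h1 := mem_negatives.1 hx
    have h2 := (hmem x).1 hx'
    omega
  · rw [hperm.mem_iff, List.mem_append, mem_negatives, hmem]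
    have := sgn_eq_or x.2
    grind

theorem HasOrdering.of_zigzag {S : Finset (ℤ × ZMod 4)} (h0 : (0 : ℤ × ZMod 4) ∉ S)
    {l : List (ℤ × ZMod 4)} (hne : l ≠ []) (hnd : l.Nodup)
    (hmem : ∀ x, x ∈ l ↔ x ∈ S ∧ sgn x.2 = -1) (hz : Zigzag Prod.fst 1 l) : HasOrdering S := by
  obtain ⟨b, l, rfl⟩ := List.exists_cons_of_ne_nil hne
  refine HasOrdering.of_negatives h0 hnd hmem fun s hs => ?_
  have hsb : sgn (step s b).2 = -1 := by simp [step, sgn_add, hs, ((hmem b).1 (by simp)).2]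
  refine Climbs.append (fun x hx => ?_) fun s' h1 h2 => Zigzag.climbs (b := b) ?_ ?_ ?_
  · have := mem_negatives.1 hx
    exact ⟨this.2.1, by rw [hsb]; linarith [this.2.2]⟩
  · rwa [h1, hsb, neg_neg]
  · exact fun x hx => ((hmem x).1 (by simp [hx])).2
  · rw [h1, hsb]
    simp only [step, hs] at h2
    linarith

theorem HasOrdering.of_pair {S : Finset (ℤ × ZMod 4)} (h0 : (0 : ℤ × ZMod 4) ∉ S)
    {x y : ℤ × ZMod 4} (hxy : x ≠ y) (hmem : ∀ z, z = x ∨ z = y ↔ z ∈ S ∧ sgn z.2 = -1)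
    (hf : x.1 = y.1) {n : ℤ × ZMod 4} (hn : n ∈ S) (hn1 : sgn n.2 = 1) (hn0 : n.1 < 0) :
    HasOrdering S := by
  refine HasOrdering.of_negatives (b := x) (l := [y]) h0 (by simpa using hxy) (by simpa using hmem)
    fun s hs => ?_
  have hx := ((hmem x).1 (by simp)).2
  have hy := ((hmem y).1 (by simp)).2
  have hsx : sgn (step s x).2 = -1 := by simp [step, sgn_add, hs, hx]
  have hneg (z) (hz : z ∈ negatives S) : sgn z.2 = 1 ∧ 0 < -1 * z.1 := by
    have := mem_negatives.1 hz
    exact ⟨this.2.1, by linarith [this.2.2]⟩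
  have hne : negatives S ≠ [] := List.ne_nil_of_mem (mem_negatives.2 ⟨hn, hn1, hn0⟩)
  obtain ⟨z, t, hzt⟩ := List.exists_cons_of_ne_nil hne
  rw [hzt] at hneg ⊢
  have hz := hneg z (by simp)
  have hsz : sgn (step (step s x) z).2 = -1 := by rw [step, sgn_add, hsx, hz.1]; rfl
  have hlt : (step s x).1 < (step (step s x) z).1 := by
    simp only [step] at hsx ⊢; rw [hsx]; linarith [hz.2]
  rw [List.cons_append, Climbs, if_pos hz.1]
  refine ⟨hlt, Climbs.append (fun w hw => ?_) fun s' h1 h2 => ?_⟩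
  · rw [hsz]; exact hneg w (by simp [hw])
  · rw [Climbs, if_neg (by rw [hy]; decide)]
    refine ⟨?_, trivial⟩
    have : (step s x).1 = s.1 + x.1 := by simp [step, hs]
    simp only [step, h1] at hsz ⊢
    rw [hsz]
    linarith

theorem zigzag_map_mirror {σ : ℤ} {l : List (ℤ × ZMod 4)} (h : Zigzag Prod.fst (-σ) l) :
    Zigzag Prod.fst σ (l.map mirror) := by
  induction l generalizing σ with
  | nil => trivial
  | cons x l ih =>
    cases l with
    | nil => trivial
    | cons y l =>
      refine ⟨?_, ih h.2⟩
      have := h.1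
      simp only [mirror]
      linarith

theorem mem_image_mirror {S : Finset (ℤ × ZMod 4)} {x : ℤ × ZMod 4} :
    x ∈ S.image mirror ↔ mirror x ∈ S := by
  nth_rw 1 [← mirror_mirror x]
  exact mirror_injective.mem_finset_image

theorem eq_mirror_iff {x y : ℤ × ZMod 4} : x = mirror y ↔ mirror x = y :=
  ⟨fun h => by rw [h, mirror_mirror], fun h => by rw [← h, mirror_mirror]⟩

theorem zero_notMem_image_mirror {S : Finset (ℤ × ZMod 4)} (h0 : (0 : ℤ × ZMod 4) ∉ S) :
    (0 : ℤ × ZMod 4) ∉ S.image mirror := by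
  rwa [mem_image_mirror, show mirror 0 = 0 by simp [mirror]]

theorem HasOrdering.of_tied {S : Finset (ℤ × ZMod 4)} (h0 : (0 : ℤ × ZMod 4) ∉ S)
    {x y : ℤ × ZMod 4} (hxy : x ≠ y) (hmem : ∀ z, z = x ∨ z = y ↔ z ∈ S ∧ sgn z.2 = -1)
    (hf : x.1 = y.1) : HasOrdering S := by
  by_cases hN : ∃ n ∈ S, sgn n.2 = 1 ∧ n.1 < 0
  · obtain ⟨n, hn, hn1, hn0⟩ := hN
    exact HasOrdering.of_pair h0 hxy hmem hf hn hn1 hn0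
  by_cases hP : ∃ n ∈ S, sgn n.2 = 1 ∧ 0 < n.1
  · obtain ⟨n, hn, hn1, hn0⟩ := hP
    refine HasOrdering.of_mirror (HasOrdering.of_pair (x := mirror x) (y := mirror y)
      (n := mirror n) (zero_notMem_image_mirror h0) (mirror_injective.ne hxy) (fun z => ?_)
      (by simp [mirror, hf]) ?_ hn1 (by simpa [mirror] using hn0))
    · rw [mem_image_mirror, show sgn z.2 = sgn (mirror z).2 from rfl, ← hmem,
        eq_mirror_iff, eq_mirror_iff]
    · rwa [mem_image_mirror, mirror_mirror]
  have hS (z) (hz : z ∈ S) : z = x ∨ z = y ∨ z = (0, 2) := by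
    have h1 := @eq_of_fst_eq_zero z (fun h => h0 (h ▸ hz))
    have h2 := hmem z
    have h3 := sgn_eq_or z.2
    grind
  have hx := (hmem x).1 (by simp)
  have hy := (hmem y).1 (by simp)
  obtain ⟨a, u⟩ := x
  obtain ⟨a', v⟩ := y
  obtain rfl : a = a' := hf
  simp only at hx hy
  have huv : u + v = 0 ∧ (u = 1 ∨ u = 3) := by
    have hne : u ≠ v := fun h => hxy (by rw [h])
    have : ∀ u v : ZMod 4, sgn u = -1 → sgn v = -1 → u ≠ v → u + v = 0 ∧ (u = 1 ∨ u = 3) := by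
      decide
    exact this u v hx.2 hy.2 hne
  by_cases hc : ((0, 2) : ℤ × ZMod 4) ∈ S
  · refine ⟨[(a, u), (0, 2), (a, v)], ?_, fun z => ?_, .of_nodup ?_⟩
    · have h2 : sgn 2 = 1 := by decide
      have : u ≠ 2 ∧ v ≠ 2 := by
        constructor <;> (rintro rfl; simp_all)
      simp only [List.nodup_cons, List.mem_cons, Prod.mk.injEq]
      grind
    · have := hS z
      grind
    · have h1 : u + 2 + v = 2 := by linear_combination huv.1
      have h2 : sgn (u + 2) = -1 := by rw [sgn_add, hx.2]; decide
      have h3 : sgn 0 = 1 := by decide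
      have h4 : u ≠ 0 ∧ u + 2 ≠ 0 ∧ u ≠ 2 ∧ u ≠ u + 2 ∧ (2 : ZMod 4) ≠ 0 ∧ u + 2 ≠ 2 := by
        rcases huv.2 with rfl | rfl <;> decide
      simp only [List.scanl_cons, List.scanl_nil, step, Prod.fst_zero, Prod.snd_zero, zero_add, h1,
        h2, h3, mul_zero, add_zero]
      simp only [List.nodup_cons, List.mem_cons, Prod.ext_iff, Prod.fst_zero, Prod.snd_zero]
      grind
  · refine ⟨[(a, u), (a, v)], by simpa using hxy, fun z => ?_, ?_⟩
    · have := hS z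
      grind
    · refine DistinctProducts.of_closed (l := []) (by simp) ?_ ?_
      · have : step 0 (a, u) = (a, u) := by simp [step, show sgn 0 = 1 by decide]
        rw [this]
        simp only [List.scanl_nil, List.mem_singleton]
        exact fun h => h0 (h ▸ hx.1)
      · simp [step, show sgn 0 = 1 by decide, hx.2, huv.1]

theorem HasOrdering.of_reflection {S : Finset (ℤ × ZMod 4)} (h0 : (0 : ℤ × ZMod 4) ∉ S)
    {r : ℤ × ZMod 4} (hr : r ∈ S) (hr1 : sgn r.2 = -1) : HasOrdering S := by
  have hrR : r ∈ S.filter fun x => sgn x.2 = -1 := by simp [hr, hr1]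
  have hpos := Finset.card_pos.2 ⟨r, hrR⟩
  have h3 : ∀ x ∈ S.filter fun x => sgn x.2 = -1, ∀ y ∈ S.filter fun x => sgn x.2 = -1,
      ∀ z ∈ S.filter fun x => sgn x.2 = -1, x ≠ y → y ≠ z → x ≠ z → x.1 = y.1 → y.1 ≠ z.1 := by
    intro x hx y hy z hz hxy hyz hxz h1 h2
    have : ∀ u v w : ZMod 4, sgn u = -1 → sgn v = -1 → sgn w = -1 → u = v ∨ v = w ∨ u = w := by
      decide
    simp only [Finset.mem_filter] at hx hy hz
    rcases this _ _ _ hx.2 hy.2 hz.2 with h | h | h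
    · exact hxy (Prod.ext h1 h)
    · exact hyz (Prod.ext h2 h)
    · exact hxz (Prod.ext (h1.trans h2) h)
  rcases exists_zigzag Prod.fst ((S.filter fun x => sgn x.2 = -1).card - 1)
      (S.filter fun x => sgn x.2 = -1) (by omega) h3 with
    ⟨x, y, hxy, hR, hf⟩ | ⟨σ, l, hσ, hnd, hmem, hz⟩
  · refine HasOrdering.of_tied h0 hxy (fun z => ?_) hf
    rw [← Finset.mem_filter (p := fun x : ℤ × ZMod 4 => sgn x.2 = -1), hR]
    simp
  · have hne : l ≠ [] := List.ne_nil_of_mem ((hmem r).2 hrR)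
    simp only [Finset.mem_filter] at hmem
    rcases hσ with rfl | rfl
    · exact HasOrdering.of_zigzag h0 hne hnd hmem hz
    · refine HasOrdering.of_mirror (HasOrdering.of_zigzag (l := l.map mirror)
        (zero_notMem_image_mirror h0) (by simpa using hne) (hnd.map mirror_injective) (fun x => ?_)
        (zigzag_map_mirror hz))
      rw [mem_image_mirror, show sgn x.2 = sgn (mirror x).2 from rfl, ← hmem,
        ← List.mem_map_of_injective mirror_injective (a := mirror x), mirror_mirror]

theorem val_eq_cons_erase {α : Type*} [DecidableEq α] {s : Finset α} {a : α} (h : a ∈ s) :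
    s.val = a ::ₘ (s.erase a).val := by
  rw [Finset.erase_val, Multiset.cons_erase h]

theorem eq_empty_of_sum_fst_nonpos {N : Finset (ℤ × ZMod 4)} (hN : ∀ x ∈ N, 0 < x.1)
    (h : (∑ x ∈ N, x).1 ≤ 0) : N = ∅ := by
  by_contra hne
  rw [Prod.fst_sum] at h
  exact absurd (Finset.sum_pos hN (Finset.nonempty_iff_ne_empty.2 hne)) (by omega)

theorem foldl_add_eq {A : Type*} [AddMonoid A] (l : List A) (a : A) :
    l.foldl (· + ·) a = a + l.sum := by
  induction l generalizing a with
  | nil => simp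
  | cons x l ih => simp [ih, add_assoc]

theorem scanl_add_concat {A : Type*} [AddMonoid A] (l : List A) (a x : A) :
    (l ++ [x]).scanl (· + ·) a = l.scanl (· + ·) a ++ [a + l.sum + x] := by
  simp [List.scanl_append, foldl_add_eq]

/-- Elements of `P` followed by `mid` and the negatives of elements of `N` can be ordered so that
the partial sums starting at `α` and ending at `β ≠ α` are distinct. -/
theorem exists_walk {mid : List (ℤ × ZMod 4)} (hmid : mid = [] ∨ mid = [(0, 2)]) (k : ℕ) :
    ∀ (P N : Finset (ℤ × ZMod 4)) (α β : ℤ × ZMod 4), P.card + N.card = k →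
    (∀ x ∈ P, 0 < x.1) → (∀ x ∈ N, 0 < x.1) → α ≠ β →
    α + ∑ x ∈ P, x + mid.sum = β + ∑ x ∈ N, x →
    ∃ L : List (ℤ × ZMod 4), (L : Multiset (ℤ × ZMod 4)) = P.val + mid + N.val.map Neg.neg ∧
      (L.scanl (· + ·) α).Nodup ∧ α + L.sum = β ∧
      ∀ t ∈ L.scanl (· + ·) α, t = α ∨ t = β ∨ min α.1 β.1 < t.1 := by
  have hmid1 : mid.sum.1 = 0 := by rcases hmid with rfl | rfl <;> simp
  have hmid0 (h : mid.sum = 0) : mid = [] := by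
    rcases hmid with rfl | rfl
    · rfl
    · exact absurd h (by decide)
  induction k with
  | zero =>
    intro P N α β hk hP hN hne hsum
    obtain rfl : P = ∅ := Finset.card_eq_zero.1 (by omega)
    obtain rfl : N = ∅ := Finset.card_eq_zero.1 (by omega)
    simp only [Finset.sum_empty, add_zero] at hsum
    refine ⟨mid, by simp, ?_, hsum, ?_⟩
    · rcases hmid with rfl | rfl
      · simp
      · simp at hsum
        simp [hsum, hne]
    · rcases hmid with rfl | rfl
      · simp
      · simp at hsum
        simp [hsum]
  | succ k ih =>
    intro P N α β hk hP hN hne hsum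
    have hsum1 := congrArg Prod.fst hsum
    simp only [Prod.fst_add, hmid1] at hsum1
    have hP0 : 0 ≤ (∑ x ∈ P, x).1 := by
      rw [Prod.fst_sum]; exact Finset.sum_nonneg fun x hx => (hP x hx).le
    have hN0 : 0 ≤ (∑ x ∈ N, x).1 := by
      rw [Prod.fst_sum]; exact Finset.sum_nonneg fun x hx => (hN x hx).le
    rcases le_or_gt α.1 β.1 with hab | hab
    · have hPne : P.Nonempty := by
        rw [Finset.nonempty_iff_ne_empty]
        rintro rfl
        simp only [Finset.sum_empty, Prod.fst_zero] at hsum1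
        have := eq_empty_of_sum_fst_nonpos hN (by linarith)
        simp [this] at hk
      by_cases hex : ∃ p ∈ P, α + p ≠ β
      · obtain ⟨p, hp, hpβ⟩ := hex
        have hp0 := hP p hp
        obtain ⟨L, hL, hnd, hs, hb⟩ := ih (P.erase p) N (α + p) β
          (by rw [Finset.card_erase_of_mem hp]; have := Finset.card_pos.2 hPne; omega)
          (fun x hx => hP x (Finset.mem_of_mem_erase hx)) hN hpβ
          (by rw [← hsum, ← Finset.add_sum_erase P _ hp]; abel)
        have hlt (t) (ht : t ∈ L.scanl (· + ·) (α + p)) : t = β ∨ α.1 < t.1 := by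
          rcases hb t ht with rfl | rfl | h
          · right; simpa using hp0
          · exact Or.inl rfl
          · right; simp only [Prod.fst_add] at h; grind
        refine ⟨p :: L, ?_, ?_, ?_, ?_⟩
        · rw [← Multiset.cons_coe, hL, val_eq_cons_erase hp]; simp
        · rw [List.scanl_cons, List.nodup_cons]
          refine ⟨fun h => ?_, hnd⟩
          rcases hlt _ h with h | h
          · exact hne h
          · exact lt_irrefl _ h
        · rw [List.sum_cons, ← add_assoc, hs]
        · intro t ht
          rw [List.scanl_cons, List.mem_cons] at ht
          rw [min_eq_left hab]
          exact ht.imp_right (hlt t)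
      · push Not at hex
        obtain ⟨p, hp⟩ := hPne
        have hpβ := hex p hp
        obtain rfl : P = {p} := by
          ext x
          rw [Finset.mem_singleton]
          exact ⟨fun hx => add_left_cancel ((hex x hx).trans hpβ.symm), fun hx => hx ▸ hp⟩
        rw [Finset.sum_singleton, hpβ, add_right_inj] at hsum
        obtain rfl : N = ∅ := eq_empty_of_sum_fst_nonpos hN (by rw [← hsum, hmid1])
        obtain rfl := hmid0 (by simpa using hsum)
        refine ⟨[p], by simp, ?_, by simpa using hpβ, ?_⟩ <;> simp [hpβ, hne]
    · have hNne : N.Nonempty := by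
        rw [Finset.nonempty_iff_ne_empty]
        rintro rfl
        simp only [Finset.sum_empty, Prod.fst_zero] at hsum1
        linarith
      by_cases hex : ∃ n ∈ N, α ≠ β + n
      · obtain ⟨n, hn, hnα⟩ := hex
        have hn0 := hN n hn
        obtain ⟨L, hL, hnd, hs, hb⟩ := ih P (N.erase n) α (β + n)
          (by rw [Finset.card_erase_of_mem hn]; have := Finset.card_pos.2 hNne; omega)
          hP (fun x hx => hN x (Finset.mem_of_mem_erase hx)) hnα
          (by rw [hsum, ← Finset.add_sum_erase N _ hn]; abel)
        have hlt (t) (ht : t ∈ L.scanl (· + ·) α) : t = α ∨ β.1 < t.1 := by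
          rcases hb t ht with rfl | rfl | h
          · exact Or.inl rfl
          · right; simpa using hn0
          · right; simp only [Prod.fst_add] at h; grind
        have hend : α + L.sum + -n = β := by rw [hs]; abel
        have hscan := scanl_add_concat L α (-n)
        rw [hend] at hscan
        refine ⟨L ++ [-n], ?_, ?_, ?_, ?_⟩
        · rw [← Multiset.coe_add, hL, val_eq_cons_erase hn, Multiset.map_cons,
            ← Multiset.singleton_add (-n), Multiset.coe_singleton]
          abel
        · rw [hscan, List.nodup_append']
          refine ⟨hnd, by simp, fun t ht ht' => ?_⟩
          rw [List.mem_singleton] at ht'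
          subst ht'
          rcases hlt _ ht with h | h
          · exact hne h.symm
          · exact lt_irrefl _ h
        · rw [List.sum_append, List.sum_singleton, ← add_assoc, hend]
        · intro t ht
          rw [hscan, List.mem_append, List.mem_singleton] at ht
          rw [min_eq_right hab.le]
          rcases ht with ht | ht
          · exact (hlt t ht).imp_right Or.inr
          · exact Or.inr (Or.inl ht)
      · push Not at hex
        obtain ⟨n, hn⟩ := hNne
        have hnα := hex n hn
        obtain rfl : N = {n} := by
          ext x
          rw [Finset.mem_singleton]
          exact ⟨fun hx => add_left_cancel ((hex x hx).symm.trans hnα), fun hx => hx ▸ hn⟩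
        rw [Finset.sum_singleton, ← hnα, add_assoc, add_eq_left] at hsum
        have hsum' := congrArg Prod.fst hsum
        simp only [Prod.fst_add, hmid1, Prod.fst_zero, add_zero] at hsum'
        obtain rfl : P = ∅ := eq_empty_of_sum_fst_nonpos hP hsum'.le
        obtain rfl := hmid0 (by simpa using hsum)
        have hβ : α + -n = β := by rw [hnα]; abel
        refine ⟨[-n], by simp, ?_, by simpa using hβ, ?_⟩ <;> simp [hβ, hne]

theorem scanl_step_eq {l : List (ℤ × ZMod 4)} {s : ℤ × ZMod 4} (hs : sgn s.2 = 1)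
    (hl : ∀ x ∈ l, sgn x.2 = 1) : l.scanl step s = l.scanl (· + ·) s := by
  induction l generalizing s with
  | nil => rfl
  | cons x l ih =>
    have hx := hl x (by simp)
    have : step s x = s + x := by simp [step, hs, Prod.ext_iff]
    rw [List.scanl_cons, List.scanl_cons, this,
      ih (by rw [Prod.snd_add, sgn_add, hs, hx]; rfl) fun y hy => hl y (by simp [hy])]

theorem foldl_step_eq {l : List (ℤ × ZMod 4)} {s : ℤ × ZMod 4} (hs : sgn s.2 = 1)
    (hl : ∀ x ∈ l, sgn x.2 = 1) : l.foldl step s = s + l.sum := by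
  induction l generalizing s with
  | nil => simp
  | cons x l ih =>
    have hx := hl x (by simp)
    have : step s x = s + x := by simp [step, hs, Prod.ext_iff]
    rw [List.foldl_cons, this,
      ih (by rw [Prod.snd_add, sgn_add, hs, hx]; rfl) fun y hy => hl y (by simp [hy]),
      List.sum_cons, add_assoc]

theorem HasOrdering.of_forall_sgn_eq_one {S : Finset (ℤ × ZMod 4)} (h0 : (0 : ℤ × ZMod 4) ∉ S)
    (hS : ∀ x ∈ S, sgn x.2 = 1) : HasOrdering S := by
  obtain ⟨mid, hmid, P, N, hP, hN, hval⟩ : ∃ mid : List (ℤ × ZMod 4),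
      (mid = [] ∨ mid = [(0, 2)]) ∧ ∃ P N : Finset (ℤ × ZMod 4), (∀ x ∈ P, 0 < x.1) ∧
      (∀ x ∈ N, 0 < x.1) ∧ S.val = P.val + mid + N.val.map Neg.neg := by
    refine ⟨if (0, 2) ∈ S then [(0, 2)] else [], by grind, S.filter fun x => 0 < x.1,
      (S.filter fun x => x.1 < 0).map (Equiv.neg _).toEmbedding, by simp, ?_, ?_⟩
    · intro x hx
      obtain ⟨y, hy, rfl⟩ := Finset.mem_map.1 hx
      simpa using (Finset.mem_filter.1 hy).2
    · have hz : (S.filter fun x => x.1 = 0).val =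
          ((if (0, 2) ∈ S then [(0, 2)] else [] : List (ℤ × ZMod 4)) : Multiset _) := by
        have : (S.filter fun x => x.1 = 0) = if (0, 2) ∈ S then {(0, 2)} else ∅ := by
          ext x
          have h1 := fun hx : x ∈ S => @eq_of_fst_eq_zero x (fun h => h0 (h ▸ hx)) (hS x hx)
          grind
        rw [this]
        split_ifs <;> rfl
      rw [← hz, Finset.map_val, Multiset.map_map]
      have hid : (Neg.neg ∘ (Equiv.neg (ℤ × ZMod 4)).toEmbedding : ℤ × ZMod 4 → ℤ × ZMod 4) =
          id := by
        ext x <;> simp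
      rw [hid, Multiset.map_id]
      have d1 : Disjoint (S.filter fun x => 0 < x.1) (S.filter fun x => x.1 = 0) :=
        Finset.disjoint_filter.2 fun x _ _ => by omega
      have d2 : Disjoint ((S.filter fun x => 0 < x.1).disjUnion (S.filter fun x => x.1 = 0) d1)
          (S.filter fun x => x.1 < 0) := by
        rw [Finset.disjoint_left]; intro x; simp; grind
      change _ = ((Finset.disjUnion _ _ d1).disjUnion _ d2).val
      congr 1
      ext x
      simp
      grind
  have of_list (L : List (ℤ × ZMod 4))
      (hL : (L : Multiset (ℤ × ZMod 4)) =
        P.val + (mid : Multiset (ℤ × ZMod 4)) + N.val.map Neg.neg) :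
      L.Nodup ∧ (∀ x, x ∈ L ↔ x ∈ S) := by
    rw [← hval] at hL
    exact ⟨by rw [← Multiset.coe_nodup, hL]; exact S.nodup,
      fun x => by rw [← Multiset.mem_coe, hL]; rfl⟩
  by_cases hτ : ∑ x ∈ P, x + mid.sum = ∑ x ∈ N, x
  swap
  · obtain ⟨L, hL, hnd, -⟩ := exists_walk hmid _ P N 0 (∑ x ∈ P, x + mid.sum - ∑ x ∈ N, x) rfl hP hN
      (fun h => hτ (sub_eq_zero.1 h.symm)) (by abel)
    have hLS := of_list L hL
    refine ⟨L, hLS.1, hLS.2, .of_nodup ?_⟩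
    rwa [scanl_step_eq (by decide) fun x hx => hS x ((hLS.2 x).1 hx)]
  have hmid1 : mid.sum.1 = 0 := by rcases hmid with rfl | rfl <;> simp
  have closed (p n : ℤ × ZMod 4) (L : List (ℤ × ZMod 4))
      (hL : ((p :: L ++ [-n] : List (ℤ × ZMod 4)) : Multiset (ℤ × ZMod 4)) =
        P.val + (mid : Multiset (ℤ × ZMod 4)) + N.val.map Neg.neg)
      (hnd : (L.scanl (· + ·) p).Nodup) (h0 : 0 ∉ L.scanl (· + ·) p) (hs : p + L.sum = n) :
      HasOrdering S := by
    have hLS := of_list _ hL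
    have hsgn (x) (hx : x ∈ p :: L ++ [-n]) : sgn x.2 = 1 := hS x ((hLS.2 x).1 hx)
    have hp : step 0 p = p := by simp [step, show sgn 0 = 1 by decide]
    have hscan : L.scanl step (step 0 p) = L.scanl (· + ·) p := by
      rw [hp, scanl_step_eq (hsgn p (by simp)) fun x hx => hsgn x (by simp [hx])]
    refine ⟨_, hLS.1, hLS.2, .of_closed (by rwa [hscan]) (by rwa [hscan]) ?_⟩
    rw [foldl_step_eq (by decide) hsgn]
    simp [← hs]
  by_cases hex : ∃ p ∈ P, ∃ n ∈ N, p ≠ n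
  · obtain ⟨p, hp, n, hn, hpn⟩ := hex
    obtain ⟨L, hL, hnd, hs, hb⟩ := exists_walk hmid _ (P.erase p) (N.erase n) p n rfl
      (fun x hx => hP x (Finset.mem_of_mem_erase hx))
      (fun x hx => hN x (Finset.mem_of_mem_erase hx)) hpn
      (by rwa [Finset.add_sum_erase P (fun x => x) hp, Finset.add_sum_erase N (fun x => x) hn])
    refine closed p n L ?_ hnd (fun h => ?_) hs
    · rw [List.cons_append, ← Multiset.cons_coe, ← Multiset.coe_add, hL, val_eq_cons_erase hp,
        val_eq_cons_erase hn, Multiset.map_cons, ← Multiset.singleton_add (-n),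
        ← Multiset.singleton_add p, ← Multiset.singleton_add p, Multiset.coe_singleton]
      abel
    · have := hP p hp
      have := hN n hn
      rcases hb 0 h with h | h | h
      · subst h; simp_all
      · subst h; simp_all
      · rw [Prod.fst_zero] at h; grind
  · push Not at hex
    have hτ1 := congrArg Prod.fst hτ
    simp only [Prod.fst_add, hmid1, add_zero] at hτ1
    have hmid0 (h : mid.sum = 0) : mid = [] := by
      rcases hmid with rfl | rfl
      · rfl
      · exact absurd h (by decide)
    rcases P.eq_empty_or_nonempty with rfl | ⟨p, hp⟩
    · obtain rfl : N = ∅ := eq_empty_of_sum_fst_nonpos hN (by rw [← hτ1]; simp)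
      obtain rfl := hmid0 (by simpa using hτ)
      have := of_list [] (by simp)
      exact ⟨[], this.1, this.2, .of_nodup (by simp)⟩
    · rcases N.eq_empty_or_nonempty with rfl | ⟨n, hn⟩
      · have := eq_empty_of_sum_fst_nonpos hP (by rw [hτ1]; simp)
        simp [this] at hp
      · obtain rfl := hex p hp n hn
        obtain rfl : P = {p} := by
          ext x
          rw [Finset.mem_singleton]
          exact ⟨fun hx => hex x hx p hn, fun hx => hx ▸ hp⟩
        obtain rfl : N = {p} := by
          ext x
          rw [Finset.mem_singleton]
          exact ⟨fun hx => (hex p hp x hx).symm, fun hx => hx ▸ hn⟩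
        obtain rfl := hmid0 (by simpa using hτ)
        refine closed p p [] (by simp; rfl) (by simp) ?_ (by simp)
        have := hP p hp
        simp only [List.scanl_nil, List.mem_singleton]
        rintro rfl
        simp at this

theorem hasOrdering {S : Finset (ℤ × ZMod 4)} (h0 : (0 : ℤ × ZMod 4) ∉ S) : HasOrdering S := by
  by_cases h : ∃ r ∈ S, sgn r.2 = -1
  · obtain ⟨r, hr, hr1⟩ := h
    exact HasOrdering.of_reflection h0 hr hr1
  · push Not at h
    exact HasOrdering.of_forall_sgn_eq_one h0 fun x hx => (sgn_eq_or x.2).resolve_right (h x hx)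

theorem card_mul_abs_foldl_step_fst_sub_le {m k : ℕ} (l : List (ℤ × ZMod 4))
    (hl : ∀ x ∈ l, |x.1| * k < m) (s : ℤ × ZMod 4) :
    |(l.foldl step s).1 - s.1| * k ≤ l.length * (m - 1) := by
  induction l generalizing s with
  | nil => simp
  | cons x l ih =>
    have h := ih (fun y hy => hl y (by simp [hy])) (step s x)
    have hx := hl x (by simp)
    have hs : |(step s x).1 - s.1| = |x.1| := by
      rcases sgn_eq_or s.2 with h | h <;> simp [step, h]
    have := mul_le_mul_of_nonneg_right
      (abs_sub_le (l.foldl step (step s x)).1 (step s x).1 s.1) (Int.natCast_nonneg k)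
    rw [hs, add_mul] at this
    rw [List.foldl_cons, List.length_cons]
    push_cast
    linarith

theorem abs_foldl_take_sub_lt {m k : ℕ} (hm : 0 < m) {l : List (ℤ × ZMod 4)}
    (hl : ∀ x ∈ l, |x.1| * k < m) (hk : l.length = k) {i j : ℕ} (hij : i < j)
    (hj : j ≤ l.length) :
    |((l.take j).foldl step 0).1 - ((l.take i).foldl step 0).1| < m := by
  obtain ⟨d, rfl⟩ := Nat.exists_eq_add_of_le hij.le
  have h := card_mul_abs_foldl_step_fst_sub_le (m := m) (k := k) ((l.drop i).take d)
    (fun x hx => hl x (List.mem_of_mem_drop (List.mem_of_mem_take hx))) ((l.take i).foldl step 0)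
  rw [← List.foldl_append, ← List.take_add] at h
  have hd : ((((l.drop i).take d).length : ℕ) : ℤ) ≤ k := by
    rw [List.length_take, List.length_drop]; omega
  have hm' : (0 : ℤ) ≤ m - 1 := by omega
  have h' := h.trans (mul_le_mul_of_nonneg_right hd hm')
  rw [mul_comm] at h'
  have := le_of_mul_le_mul_left h' (by omega)
  omega

/-- A simultaneous Dirichlet approximation in `ZMod m`. -/
theorem exists_dilation {ι : Type*} [Fintype ι] {m k : ℕ} (hm : 0 < m) (hk : 2 ≤ k)
    (hι : Fintype.card ι = k) (z : ι → ZMod m) :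
    ∃ c : ℕ, 0 < c ∧ c ≤ k ^ k ∧ ∀ i, |((c : ZMod m) * z i).valMinAbs| * k < m := by
  classical
  have : NeZero m := ⟨hm.ne'⟩
  let box (t : Fin (k ^ k + 1)) (i : ι) : Fin k :=
    ⟨k * (((t : ℕ) : ZMod m) * z i).val / m,
      Nat.div_lt_of_lt_mul <| by
        rw [mul_comm m]; exact Nat.mul_lt_mul_of_pos_left (ZMod.val_lt _) (by omega)⟩
  obtain ⟨t₁, t₂, hlt, hbox⟩ : ∃ t₁ t₂, t₁ < t₂ ∧ box t₁ = box t₂ := by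
    obtain ⟨t₁, t₂, hne, h⟩ := Fintype.exists_ne_map_eq_of_card_lt box (by simp [hι])
    rcases lt_or_gt_of_ne hne with h' | h'
    exacts [⟨t₁, t₂, h', h⟩, ⟨t₂, t₁, h', h.symm⟩]
  refine ⟨t₂ - t₁, by omega, by omega, fun i => ?_⟩
  have hq := congrArg Fin.val (congrFun hbox i)
  simp only [box] at hq
  set v₁ := (((t₁ : ℕ) : ZMod m) * z i).val with hv₁
  set v₂ := (((t₂ : ℕ) : ZMod m) * z i).val with hv₂
  have e₁ := Nat.div_add_mod (k * v₁) m
  have e₂ := Nat.div_add_mod (k * v₂) m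
  have l₁ := Nat.mod_lt (k * v₁) hm
  have l₂ := Nat.mod_lt (k * v₂) hm
  rw [hq] at e₁
  have hd : |(v₂ : ℤ) - v₁| * k < m := by
    rw [← abs_of_nonneg (Int.natCast_nonneg k), ← abs_mul, abs_lt]
    zify at e₁ e₂ l₁ l₂
    have p₁ : (0 : ℤ) ≤ (k * v₁ : ℤ) % m := Int.emod_nonneg _ (by omega)
    have p₂ : (0 : ℤ) ≤ (k * v₂ : ℤ) % m := Int.emod_nonneg _ (by omega)
    constructor <;> linarith
  have hval : (((t₂ - t₁ : ℕ) : ZMod m) * z i).valMinAbs = (v₂ : ℤ) - v₁ := by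
    rw [ZMod.valMinAbs_spec]
    refine ⟨?_, ?_⟩
    · push_cast [Nat.cast_sub hlt.le]
      rw [hv₁, hv₂, ZMod.natCast_zmod_val, ZMod.natCast_zmod_val, sub_mul]
    · have h2 : |(v₂ : ℤ) - v₁| * 2 < m := lt_of_le_of_lt
        (mul_le_mul_of_nonneg_left (by exact_mod_cast hk) (abs_nonneg _)) hd
      have := le_abs_self ((v₂ : ℤ) - v₁)
      have := neg_abs_le ((v₂ : ℤ) - v₁)
      constructor <;> linarith
  rwa [hval]

/-- Twice a parity, as an element of `ZMod 4`. -/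
def double (x : ZMod 2) : ZMod 4 := if x = 0 then 0 else 2

/-- The coordinate of an element of the dicyclic group in `ZMod m`, for `m` odd. -/
def zmodCoord {m : ℕ} : QuaternionGroup m → ZMod m
  | .a i => ZMod.castHom (dvd_mul_left m 2) (ZMod m) i
  | .xa i => -ZMod.castHom (dvd_mul_left m 2) (ZMod m) i

/-- The coordinate of an element of the dicyclic group in `ZMod 4`, for `m` odd. -/
def signCoord {m : ℕ} : QuaternionGroup m → ZMod 4
  | .a i => double (ZMod.castHom (dvd_mul_right 2 m) (ZMod 2) i)
  | .xa i => 1 + double (ZMod.castHom (dvd_mul_right 2 m) (ZMod 2) i)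

theorem sgn_double : ∀ x, sgn (double x) = 1 := by decide

theorem sgn_one_add_double : ∀ x, sgn (1 + double x) = -1 := by decide

theorem double_add : ∀ x y, double (x + y) = double x + double y := by decide

theorem zmodCoord_mul {m : ℕ} (g h : QuaternionGroup m) :
    zmodCoord (g * h) = zmodCoord g + (sgn (signCoord g) : ZMod m) * zmodCoord h := by
  rcases g with i | i <;> rcases h with j | j <;>
    simp only [QuaternionGroup.a_mul_a, QuaternionGroup.a_mul_xa, QuaternionGroup.xa_mul_a,
      QuaternionGroup.xa_mul_xa, zmodCoord, signCoord, sgn_double, sgn_one_add_double, map_add,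
      map_sub, map_natCast, CharP.cast_eq_zero] <;>
    push_cast <;> ring

theorem signCoord_mul {m : ℕ} (hm : Odd m) (g h : QuaternionGroup m) :
    signCoord (g * h) = signCoord g + signCoord h := by
  have h1 : ((m : ℕ) : ZMod 2) = 1 := (ZMod.natCast_eq_one_iff_odd).2 hm
  have h2 : ∀ x y, 1 + double (y - x) = double x + (1 + double y) := by decide
  have h4 : ∀ x y, double (1 + y - x) = 1 + double x + (1 + double y) := by decide
  rcases g with i | i <;> rcases h with j | j <;>
    simp only [QuaternionGroup.a_mul_a, QuaternionGroup.a_mul_xa, QuaternionGroup.xa_mul_a,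
      QuaternionGroup.xa_mul_xa, signCoord, map_add, map_sub, map_natCast, h1, h2, h4,
      double_add, add_assoc]

theorem eq_of_castHom_eq {m : ℕ} (hm : Odd m) {i j : ZMod (2 * m)}
    (h : ZMod.castHom (dvd_mul_left m 2) (ZMod m) i = ZMod.castHom (dvd_mul_left m 2) (ZMod m) j)
    (h' : ZMod.castHom (dvd_mul_right 2 m) (ZMod 2) i =
      ZMod.castHom (dvd_mul_right 2 m) (ZMod 2) j) : i = j := by
  have hc : Nat.Coprime 2 m := (Nat.coprime_two_left).2 hm
  obtain ⟨i, rfl⟩ := ZMod.intCast_surjective i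
  obtain ⟨j, rfl⟩ := ZMod.intCast_surjective j
  rw [map_intCast, map_intCast, ZMod.intCast_eq_intCast_iff_dvd_sub] at h h'
  rw [ZMod.intCast_eq_intCast_iff_dvd_sub]
  push_cast at h' ⊢
  exact IsCoprime.mul_dvd (by exact_mod_cast Nat.isCoprime_iff_coprime.2 hc) h' h

theorem eq_of_coords_eq {m : ℕ} (hm : Odd m) {g h : QuaternionGroup m}
    (hz : zmodCoord g = zmodCoord h) (hs : signCoord g = signCoord h) : g = h := by
  have inj : ∀ x y, double x = double y → x = y := by decide
  have ne : ∀ x y, double x ≠ 1 + double y := by decide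
  rcases g with i | i <;> rcases h with j | j <;> simp only [zmodCoord, signCoord] at hz hs
  · rw [eq_of_castHom_eq hm hz (inj _ _ hs)]
  · exact absurd hs (ne _ _)
  · exact absurd hs.symm (ne _ _)
  · rw [eq_of_castHom_eq hm (neg_injective hz) (inj _ _ (add_left_cancel hs))]

/-- The lift to `ℤ ⋊ ZMod 4` of the dilation by `c` of an element of the dicyclic group. -/
def dilate {m : ℕ} (c : ZMod m) (g : QuaternionGroup m) : ℤ × ZMod 4 :=
  ((c * zmodCoord g).valMinAbs, signCoord g)

theorem foldl_map_dilate {m : ℕ} (hm : Odd m) (c : ZMod m) (l : List (QuaternionGroup m))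
    (g : QuaternionGroup m) (s : ℤ × ZMod 4) (hs : (s.1 : ZMod m) = c * zmodCoord g)
    (hs' : s.2 = signCoord g) :
    (((l.map (dilate c)).foldl step s).1 : ZMod m) = c * zmodCoord (g * l.prod) ∧
      ((l.map (dilate c)).foldl step s).2 = signCoord (g * l.prod) := by
  induction l generalizing g s with
  | nil => simp [hs, hs']
  | cons x l ih =>
    rw [List.map_cons, List.foldl_cons, List.prod_cons, ← mul_assoc]
    refine ih (g * x) _ ?_ ?_
    · simp only [step, dilate]
      push_cast
      rw [hs, hs', zmodCoord_mul]
      ring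
    · simp only [step, dilate, hs', signCoord_mul hm]

theorem isSequenceable_of_dilation {m k c : ℕ} (hm : Odd m) (hc : c.Coprime m)
    {S : Finset (QuaternionGroup m)} (hcard : S.card = k) (h1 : (1 : QuaternionGroup m) ∉ S)
    (hw : ∀ g ∈ S, |((c : ZMod m) * zmodCoord g).valMinAbs| * k < m) : IsSequenceable S := by
  have : NeZero m := ⟨hm.pos.ne'⟩
  have hu : IsUnit (c : ZMod m) := (ZMod.isUnit_iff_coprime c m).2 hc
  have hz1 : zmodCoord (1 : QuaternionGroup m) = 0 := map_zero _
  have hs1 : signCoord (1 : QuaternionGroup m) = 0 := by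
    change double (ZMod.castHom _ _ 0) = 0
    rw [map_zero]; rfl
  have hinj : Function.Injective (dilate (c : ZMod m)) := fun g h he =>
    eq_of_coords_eq hm
      (hu.mul_left_cancel (ZMod.injective_valMinAbs (congrArg Prod.fst he))) (congrArg Prod.snd he)
  have hl1 : dilate (c : ZMod m) 1 = 0 := by simp [dilate, hz1, hs1]
  obtain ⟨l', hnd, hmem, hd⟩ := hasOrdering (S := S.image (dilate (c : ZMod m)))
    (by rwa [← hl1, hinj.mem_finset_image])
  obtain ⟨l, rfl⟩ : ∃ l : List (QuaternionGroup m), l.map (dilate (c : ZMod m)) = l' := by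
    rw [← Set.mem_range, Set.range_list_map]
    intro x hx
    obtain ⟨g, -, rfl⟩ := Finset.mem_image.1 ((hmem x).1 hx)
    exact ⟨g, rfl⟩
  have hlS (g) : g ∈ l ↔ g ∈ S := by
    rw [← hinj.mem_finset_image, ← hmem, List.mem_map_of_injective hinj]
  have hlen : l.length = k := by
    rw [← hcard, ← List.toFinset_card_of_nodup hnd.of_map]
    congr 1
    ext g
    rw [List.mem_toFinset, hlS]
  refine ⟨l, hnd.of_map, hlS, fun i j hij hj hne he => ?_⟩
  have st (i) := foldl_map_dilate hm c (l.take i) 1 0 (by simp [hz1]) (by simp [hs1])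
  simp only [one_mul, List.map_take] at st
  refine hd i j hij (by simpa using hj) (by simpa using hne) (Prod.ext ?_ ?_)
  · have hB : ∀ x ∈ l.map (dilate (c : ZMod m)), |x.1| * k < m := by
      intro x hx
      obtain ⟨g, hg, rfl⟩ := List.mem_map.1 hx
      exact hw g ((hlS g).1 hg)
    have hcong := (st i).1.trans ((congrArg _ (congrArg _ he)).trans (st j).1.symm)
    rw [ZMod.intCast_eq_intCast_iff_dvd_sub] at hcong
    refine (sub_eq_zero.1 (Int.eq_zero_of_abs_lt_dvd hcong ?_)).symm
    exact abs_foldl_take_sub_lt hm.pos hB (by simpa using hlen) hij (by simpa using hj)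
  · rw [(st i).2, (st j).2, he]

end InfiniteDicyclic

/-- Any subset of size `k` of the dicyclic group `Dic_m` (of order `4m`) not containing
the identity is sequenceable, provided every prime factor of `m` exceeds `k^k`. -/
theorem dicyclic_sequenceable (m k : ℕ) (hm : 0 < m) (hk : 0 < k)
    (hprime : ∀ p : ℕ, p.Prime → p ∣ m → k ^ k < p)
    (S : Finset (QuaternionGroup m)) (hcard : S.card = k)
    (h1 : (1 : QuaternionGroup m) ∉ S) :
    IsSequenceable S := by
  rcases Nat.eq_or_lt_of_le hk with hk1 | hk2
  · obtain ⟨x, rfl⟩ := Finset.card_eq_one.1 (hcard.trans hk1.symm)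
    refine ⟨[x], by simp, by simp, fun i j hij hj hne => ?_⟩
    simp only [List.length_singleton] at hj hne
    omega
  · have hodd : Odd m := by
      rw [← Nat.not_even_iff_odd, even_iff_two_dvd]
      intro h
      have := hprime 2 Nat.prime_two h
      have := Nat.le_self_pow (n := k) (by omega) k
      omega
    obtain ⟨c, hc0, hck, hc⟩ := InfiniteDicyclic.exists_dilation (ι := S) hm hk2 (by simpa)
      fun g => InfiniteDicyclic.zmodCoord g.1
    refine InfiniteDicyclic.isSequenceable_of_dilation hodd (c := c) ?_ hcard h1
      fun g hg => hc ⟨g, hg⟩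
    refine Nat.Coprime.symm (Nat.coprime_of_dvd fun p hp hpm hpc => ?_)
    have := Nat.le_of_dvd hc0 hpc
    have := hprime p hp hpm
    omega
end

section
/- The semidirect product Z ⋊_φ Z_4, where φ : Z_4 → Aut(Z) is the homomorphism with φ(1)(x) = −x, is strongly sequenceable: every finite subset of it not containing 0 is sequenceable. -/
/-- A group is *strongly sequenceable* if every finite subset not containing the
identity is sequenceable. -/
def StronglySequenceable (G : Type*) [Group G] : Prop :=
  ∀ S : Finset G, (1 : G) ∉ S → IsSequenceable S

/-- No nonempty proper contiguous block of the list has product one. -/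
def BlockFree {G : Type*} [Group G] (l : List G) : Prop :=
  ∀ u v w : List G, u ++ v ++ w = l → v ≠ [] → (u ≠ [] ∨ w ≠ []) → v.prod ≠ 1

theorem BlockFree.isSequenceable {G : Type*} [Group G] {S : Finset G} {l : List G}
    (h : BlockFree l) (hl : l.Perm S.toList) : IsSequenceable S := by
  refine ⟨l, hl.nodup_iff.2 S.nodup_toList, fun x => by rw [hl.mem_iff, Finset.mem_toList], ?_⟩
  intro i j hij hj hne heq
  have htake : l.take j = l.take i ++ (l.take j).drop i := by
    conv_lhs => rw [← List.take_append_drop i (l.take j)]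
    rw [List.take_take, min_eq_left hij.le]
  refine h (l.take i) ((l.take j).drop i) (l.drop j) ?_ ?_ ?_ ?_
  · rw [← htake, List.take_append_drop]
  · intro h0
    have := congrArg List.length h0
    simp at this
    omega
  · by_contra! hc
    have h1 := congrArg List.length hc.1
    have h2 := congrArg List.length hc.2
    simp at h1 h2
    rcases h1 with h1 | h1
    · exact hne ⟨h1, by omega⟩
    · subst h1
      simp at hj
      omega
  · rw [htake, List.prod_append] at heq
    exact (left_eq_mul.1 heq)

theorem BlockFree.reverse {G : Type*} [CommGroup G] {l : List G} (h : BlockFree l) :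
    BlockFree l.reverse := by
  intro u v w huvw hv huw
  have := h w.reverse v.reverse u.reverse (by rw [← List.reverse_inj, ← huvw]; simp)
    (by simpa using hv) (by simpa using huw.symm)
  rwa [List.prod_reverse] at this

theorem blockFree_of_length_le_one {G : Type*} [Group G] {l : List G} (h : l.length ≤ 1) :
    BlockFree l := by
  intro u v w huvw hv huw
  subst huvw
  have := List.length_pos_iff.2 hv
  simp at h
  rcases huw with h' | h' <;> have := List.length_pos_iff.2 h' <;> omega

theorem IsSequenceable.map {K G : Type*} [Group K] [Group G] {S : Finset K}
    (h : IsSequenceable S) (f : K →* G) (hf : Function.Injective f) :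
    IsSequenceable (S.map ⟨f, hf⟩) := by
  obtain ⟨l, hnd, hmem, hl⟩ := h
  refine ⟨l.map f, hnd.map hf, fun x => by simp [hmem], ?_⟩
  intro i j hij hj hne heq
  rw [List.length_map] at hj hne
  rw [← List.map_take, ← List.map_take, ← map_list_prod, ← map_list_prod] at heq
  exact hl i j hij hj hne (hf heq)

section Additive

variable {K : Type*} [CommGroup K] (pos : K → ℤ) (hmul : ∀ g h, pos (g * h) = pos g + pos h)

include hmul

theorem pos_one_of_mul : pos 1 = 0 := by
  have := hmul 1 1
  simp at this
  exact this

theorem pos_list_prod_nonneg {l : List K} (h : ∀ z ∈ l, 0 ≤ pos z) : 0 ≤ pos l.prod := by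
  induction l with
  | nil => simp [pos_one_of_mul pos hmul]
  | cons a t ih =>
    simp only [List.forall_mem_cons] at h
    rw [List.prod_cons, hmul]
    have := ih h.2
    omega

theorem pos_list_prod_neg {l : List K} (hl : l ≠ []) (h : ∀ z ∈ l, pos z < 0) :
    pos l.prod < 0 := by
  induction l with
  | nil => exact absurd rfl hl
  | cons a t ih =>
    simp only [List.forall_mem_cons] at h
    rw [List.prod_cons, hmul]
    rcases eq_or_ne t [] with rfl | ht
    · simp only [List.prod_nil, pos_one_of_mul pos hmul]
      omega
    · have := ih ht h.2
      omega

theorem BlockFree.cons_of_pos {a : K} {p q : List K} (h : BlockFree (p ++ q)) (ha : 0 < pos a)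
    (hp : ∀ z ∈ p, 0 ≤ pos z) (hq : ∀ z ∈ q, pos z < 0)
    (hne : (p ++ q).prod = 1 → p ++ q = []) (htot : 0 ≤ pos (a :: (p ++ q)).prod) :
    BlockFree (a :: (p ++ q)) := by
  intro u v w huvw hv huw hprod
  rcases u with _ | ⟨a', u⟩
  · rcases v with _ | ⟨a', t⟩
    · exact hv rfl
    simp only [List.nil_append, List.cons_append, List.cons.injEq] at huvw
    obtain ⟨rfl, htw⟩ := huvw
    have hw : w ≠ [] := by simpa using huw
    have h0 : pos a' + pos t.prod = 0 := by
      rw [← hmul, ← List.prod_cons, hprod, pos_one_of_mul pos hmul]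
    rw [← htw, List.prod_cons, List.prod_append, hmul, hmul] at htot
    rcases List.append_eq_append_iff.1 htw with ⟨s, hs, _⟩ | ⟨s, _, hs⟩
    · have : 0 ≤ pos t.prod :=
        pos_list_prod_nonneg pos hmul fun z hz => hp z (by rw [hs]; simp [hz])
      omega
    · have : pos w.prod < 0 :=
        pos_list_prod_neg pos hmul hw fun z hz => hq z (by rw [hs]; simp [hz])
      omega
  · simp only [List.cons_append, List.cons.injEq] at huvw
    obtain ⟨rfl, hr⟩ := huvw
    by_cases hc : u ≠ [] ∨ w ≠ []
    · exact h u v w hr hv hc hprod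
    · push Not at hc
      obtain ⟨rfl, rfl⟩ := hc
      simp only [List.nil_append, List.append_nil] at hr
      exact hv (hr.trans (hne (hr ▸ hprod)))

open Classical in
theorem exists_blockFree_of_erase {A B m : List K} (hA : ∀ a ∈ A, 0 < pos a) (hAnd : A.Nodup)
    (hB : ∀ b ∈ B, pos b < 0) (hm : m.length ≤ 1) (hm0 : ∀ z ∈ m, z ≠ 1 ∧ pos z = 0)
    (hne : A ≠ []) (htot : 0 ≤ pos (A ++ m ++ B).prod)
    (ih : ∀ a ∈ A, ∃ la lb : List K, la.Perm (A.erase a) ∧ lb.Perm B ∧ BlockFree (la ++ m ++ lb)) :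
    ∃ la lb : List K, la.Perm A ∧ lb.Perm B ∧ BlockFree (la ++ m ++ lb) := by
  have hchoice : ∃ a ∈ A, (A.erase a ++ m ++ B).prod = 1 → A.erase a ++ m ++ B = [] := by
    by_contra! hc
    have hprod : ∀ a ∈ A, a = (A ++ m ++ B).prod := by
      intro a ha
      have h1 := (hc a ha).1
      have h2 := ((List.perm_cons_erase ha).append_right m).append_right B |>.prod_eq
      rw [h2, List.cons_append, List.cons_append, List.prod_cons, h1, mul_one]
    obtain ⟨a, t, rfl⟩ := List.exists_cons_of_ne_nil hne
    have ht : t = [] := by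
      rcases t with _ | ⟨a', t⟩
      · rfl
      · have := (hprod a (by simp)).trans (hprod a' (by simp)).symm
        simp [this] at hAnd
    subst ht
    obtain ⟨h1, h2⟩ := hc a (by simp)
    simp only [List.erase_cons_head, List.nil_append, List.prod_append] at h1 h2
    have hmp : pos m.prod + pos B.prod = 0 := by rw [← hmul, h1, pos_one_of_mul pos hmul]
    have hm' : 0 ≤ pos m.prod ∧ pos m.prod ≤ 0 ∧ (m.prod = 1 → m = []) := by
      rcases m with _ | ⟨z, _ | ⟨z', m⟩⟩
      · simp [pos_one_of_mul pos hmul]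
      · simp at hm0
        simp [hm0]
      · simp at hm
    have hBnil : B = [] := by
      by_contra hB'
      have := pos_list_prod_neg pos hmul hB' hB
      omega
    subst hBnil
    simp only [List.prod_nil, mul_one] at h1
    simp [hm'.2.2 h1] at h2
  obtain ⟨a, ha, hrest⟩ := hchoice
  obtain ⟨la, lb, hla, hlb, hbf⟩ := ih a ha
  have hperm : (la ++ m ++ lb).Perm (A.erase a ++ m ++ B) := (hla.append_right m).append hlb
  have hperm' : (a :: (la ++ m ++ lb)).Perm (A ++ m ++ B) :=
    (hperm.cons a).trans
      (((List.perm_cons_erase ha).symm.append_right m).append_right B)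
  refine ⟨a :: la, lb, (hla.cons a).trans (List.perm_cons_erase ha).symm, hlb, ?_⟩
  refine hbf.cons_of_pos pos hmul (hA a ha) ?_ ?_ ?_ ?_
  · intro z hz
    rcases List.mem_append.1 hz with hz | hz
    · exact (hA z (List.mem_of_mem_erase (hla.mem_iff.1 hz))).le
    · exact (hm0 z hz).2.ge
  · exact fun z hz => hB z (hlb.mem_iff.1 hz)
  · intro h1
    rw [hperm.prod_eq] at h1
    have := hrest h1
    rw [this] at hperm
    exact hperm.eq_nil
  · rw [hperm'.prod_eq]
    exact htot

open Classical in
theorem exists_blockFree_perm {m : List K} (hm : m.length ≤ 1)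
    (hm0 : ∀ z ∈ m, z ≠ 1 ∧ pos z = 0) (n : ℕ) :
    ∀ A B : List K, A.length + B.length = n → A.Nodup → B.Nodup → (∀ a ∈ A, 0 < pos a) →
      (∀ b ∈ B, pos b < 0) →
      ∃ la lb : List K, la.Perm A ∧ lb.Perm B ∧ BlockFree (la ++ m ++ lb) := by
  have hrev : m.reverse = m := by
    rcases m with _ | ⟨z, _ | ⟨z', m⟩⟩
    · rfl
    · rfl
    · simp at hm
  have hswap : ∀ A B : List K,
      (∃ la lb : List K, la.Perm A ∧ lb.Perm B ∧ BlockFree (la ++ m ++ lb)) →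
      ∃ lb la : List K, lb.Perm B ∧ la.Perm A ∧ BlockFree (lb ++ m ++ la) := by
    rintro A B ⟨la, lb, hla, hlb, h⟩
    refine ⟨lb.reverse, la.reverse, lb.reverse_perm.trans hlb, la.reverse_perm.trans hla, ?_⟩
    have := h.reverse
    simpa [hrev] using this
  induction n using Nat.strong_induction_on with
  | _ n ih =>
  intro A B hn hAnd hBnd hA hB
  rcases le_or_gt 0 (pos (A ++ m ++ B).prod) with htot | htot
  · rcases eq_or_ne A [] with rfl | hne
    · rcases eq_or_ne B [] with rfl | hBne
      · exact ⟨[], [], .refl _, .refl _, by simpa using blockFree_of_length_le_one hm⟩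
      · rw [List.nil_append, List.prod_append, hmul] at htot
        have h1 := pos_list_prod_neg pos hmul hBne hB
        have h2 : 0 ≤ -pos m.prod :=
          pos_list_prod_nonneg (fun z => -pos z) (fun g h => by rw [hmul]; ring)
            (fun z hz => by simp [(hm0 z hz).2])
        omega
    · refine exists_blockFree_of_erase pos hmul hA hAnd hB hm hm0 hne htot fun a ha => ?_
      have h1 := List.length_erase_of_mem ha
      have h2 := List.length_pos_iff.2 hne
      exact ih _ (by omega) (A.erase a) B rfl (hAnd.erase a) hBnd
        (fun z hz => hA z (List.mem_of_mem_erase hz)) hB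
  · have hne : B ≠ [] := by
      rintro rfl
      have : 0 ≤ pos (A ++ m ++ []).prod := by
        refine pos_list_prod_nonneg pos hmul fun z hz => ?_
        simp only [List.append_nil, List.mem_append] at hz
        rcases hz with hz | hz
        · exact (hA z hz).le
        · exact (hm0 z hz).2.ge
      omega
    refine hswap _ _ ?_
    refine exists_blockFree_of_erase (fun z => -pos z) (fun g h => by rw [hmul]; ring)
      (fun b hb => by simpa using hB b hb) hBnd (fun a ha => by simpa using hA a ha) hm
      (fun z hz => by simpa using hm0 z hz) hne ?_ fun b hb => hswap _ _ ?_
    · have : (B ++ m ++ A).Perm (A ++ m ++ B) := by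
        rw [List.append_assoc A]
        exact List.perm_append_comm.trans ((List.perm_append_comm).append_left A)
      rw [this.prod_eq]
      omega
    · have h1 := List.length_erase_of_mem hb
      have h2 := List.length_pos_iff.2 hne
      exact ih _ (by omega) A (B.erase b) rfl hAnd (hBnd.erase b) hA
        (fun z hz => hB z (List.mem_of_mem_erase hz))

open Classical in
theorem isSequenceable_of_pos {S : Finset K} (h1 : 1 ∉ S)
    (h0 : ∀ g ∈ S, ∀ h ∈ S, pos g = 0 → pos h = 0 → g = h) : IsSequenceable S := by
  have hm : (S.filter fun g => pos g = 0).toList.length ≤ 1 := by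
    rw [Finset.length_toList, Finset.card_le_one]
    intro a ha b hb
    rw [Finset.mem_filter] at ha hb
    exact h0 a ha.1 b hb.1 ha.2 hb.2
  obtain ⟨la, lb, hla, hlb, h⟩ := exists_blockFree_perm pos hmul hm
    (fun z hz => by
      rw [Finset.mem_toList, Finset.mem_filter] at hz
      exact ⟨fun h => h1 (h ▸ hz.1), hz.2⟩) _
    (S.filter fun g => 0 < pos g).toList (S.filter fun g => pos g < 0).toList rfl
    (Finset.nodup_toList _) (Finset.nodup_toList _) (by simp) (by simp)
  refine h.isSequenceable ?_
  refine ((hla.append_right _).append hlb).trans ?_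
  rw [List.perm_ext_iff_of_nodup _ S.nodup_toList]
  · intro x
    simp only [List.mem_append, Finset.mem_toList, Finset.mem_filter]
    have := lt_trichotomy 0 (pos x)
    grind
  · simp only [List.nodup_append, Finset.nodup_toList, List.mem_append, Finset.mem_toList,
      Finset.mem_filter, true_and]
    grind

end Additive

/-- A height function on a group, twisted by a sign character: the height behaves like the
translation part of an isometry of `ℤ`, and its joint fibres with the sign have at most two
elements. -/
structure TwistedHeight (G : Type*) [Group G] where
  pos : G → ℤ
  sgn : G → ℤ
  z : G
  sgn_mul : ∀ g h, sgn (g * h) = sgn g * sgn h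
  sgn_eq : ∀ g, sgn g = 1 ∨ sgn g = -1
  pos_mul : ∀ g h, pos (g * h) = pos g + sgn g * pos h
  eq_or_eq : ∀ g h, pos g = pos h → sgn g = sgn h → h = g ∨ h = g * z
  comm : ∀ g h, sgn g = 1 → sgn h = 1 → g * h = h * g

namespace TwistedHeight

variable {G : Type*} [Group G] (H : TwistedHeight G)

/-- The twisted height with the orientation of `ℤ` reversed. -/
def neg : TwistedHeight G where
  pos g := -H.pos g
  sgn := H.sgn
  z := H.z
  sgn_mul := H.sgn_mul
  sgn_eq := H.sgn_eq
  pos_mul g h := by rw [H.pos_mul]; ring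
  eq_or_eq g h hp := H.eq_or_eq g h (by omega)
  comm := H.comm

theorem sgn_one : H.sgn 1 = 1 := by
  have h := H.sgn_mul 1 1
  rcases H.sgn_eq 1 with h1 | h1
  · exact h1
  · rw [one_mul, h1] at h
    omega

theorem pos_one : H.pos 1 = 0 := by
  have h := H.pos_mul 1 1
  rw [one_mul, H.sgn_one] at h
  omega

/-- Along the list, the walk with initial orientation `e` strictly climbs on each of its two
levels, where at the start the other level lies `r` below the current position. -/
def Climb : ℤ → ℤ → List G → Prop
  | _, _, [] => True
  | e, r, g :: l =>
    (H.sgn g = 1 → 0 < e * H.pos g ∧ Climb e (r + e * H.pos g) l) ∧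
    (H.sgn g = -1 → 0 < r + e * H.pos g ∧ Climb (-e) (e * H.pos g) l)

variable {H}

theorem Climb.mono {l : List G} {e r r' : ℤ} (h : H.Climb e r l) (hr : r ≤ r') :
    H.Climb e r' l := by
  induction l generalizing r r' with
  | nil => trivial
  | cons g l ih =>
    refine ⟨fun hg => ⟨(h.1 hg).1, ih (h.1 hg).2 (by omega)⟩, fun hg => ⟨?_, (h.2 hg).2⟩⟩
    have := (h.2 hg).1
    omega

theorem Climb.append {l t : List G} {e r : ℤ} (h : H.Climb e r t)
    (hl : ∀ g ∈ l, H.sgn g = 1 ∧ 0 < e * H.pos g) : H.Climb e r (l ++ t) := by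
  induction l generalizing r with
  | nil => exact h
  | cons g l ih =>
    simp only [List.forall_mem_cons] at hl
    refine ⟨fun _ => ⟨hl.1.2, ih (h.mono (by omega)) hl.2⟩, fun hg => ?_⟩
    omega

theorem Climb.of_append {l t : List G} {e r : ℤ} (h : H.Climb e r (l ++ t)) :
    ∃ e' r', H.Climb e' r' t := by
  induction l generalizing e r with
  | nil => exact ⟨e, r, h⟩
  | cons g l ih =>
    rcases H.sgn_eq g with hg | hg
    · exact ih (h.1 hg).2
    · exact ih (h.2 hg).2

theorem Climb.pos_prod_of_append {v w : List G} {e r : ℤ} (h : H.Climb e r (v ++ w))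
    (hv : v ≠ []) :
    (H.sgn v.prod = 1 → 0 < e * H.pos v.prod) ∧
      (H.sgn v.prod = -1 → 0 < r + e * H.pos v.prod) := by
  induction v generalizing e r with
  | nil => exact absurd rfl hv
  | cons g v ih =>
    rw [List.prod_cons, H.pos_mul, H.sgn_mul]
    rcases eq_or_ne v [] with rfl | hv'
    · rw [List.prod_nil, H.pos_one, H.sgn_one, mul_one, mul_zero, add_zero]
      exact ⟨fun hg => (h.1 hg).1, fun hg => (h.2 hg).1⟩
    · rcases H.sgn_eq g with hg | hg
      · obtain ⟨h1, h2⟩ := h.1 hg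
        have := ih h2 hv'
        rw [hg, one_mul, one_mul, mul_add]
        exact ⟨fun hs => by linarith [this.1 hs], fun hs => by linarith [this.2 hs]⟩
      · obtain ⟨h1, h2⟩ := h.2 hg
        have := ih h2 hv'
        rw [hg]
        exact ⟨fun hs => by linarith [this.2 (by omega)],
          fun hs => by linarith [this.1 (by omega)]⟩

theorem Climb.prod_ne_one {u v w : List G} {e r : ℤ} (h : H.Climb e r (u ++ v ++ w))
    (hv : v ≠ []) : v.prod ≠ 1 := by
  intro h1
  rw [List.append_assoc] at h
  obtain ⟨e', r', h'⟩ := h.of_append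
  have := (h'.pos_prod_of_append hv).1
  rw [h1, H.pos_one, H.sgn_one] at this
  simp at this

theorem Climb.blockFree_append {l m : List G} {r : ℤ} (h : H.Climb 1 r l) (hm : m.length ≤ 1)
    (hm0 : ∀ g ∈ m, g ≠ 1 ∧ H.sgn g = 1 ∧ H.pos g = 0) : BlockFree (m ++ l) := by
  intro u v w huvw hv _
  rcases m with _ | ⟨c, _ | ⟨c', m⟩⟩
  · simp only [List.nil_append] at huvw
    exact Climb.prod_ne_one (huvw ▸ h) hv
  · rcases u with _ | ⟨c', u⟩
    · rcases v with _ | ⟨c', v⟩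
      · exact absurd rfl hv
      simp only [List.nil_append, List.cons_append, List.cons.injEq] at huvw
      obtain ⟨rfl, rfl⟩ := huvw
      simp only [List.mem_singleton, forall_eq] at hm0
      obtain ⟨hc1, hcs, hcp⟩ := hm0
      rcases eq_or_ne v [] with rfl | hv'
      · simpa using hc1
      · intro hprod
        have h1 := congrArg H.pos hprod
        have h2 := congrArg H.sgn hprod
        rw [List.prod_cons, H.pos_mul, hcs, hcp, H.pos_one] at h1
        rw [List.prod_cons, H.sgn_mul, hcs, H.sgn_one] at h2
        have := (h.pos_prod_of_append hv').1
        omega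
    · simp only [List.nil_append, List.cons_append, List.cons.injEq] at huvw
      exact Climb.prod_ne_one (huvw.2 ▸ h) hv
  · simp at hm

variable (H)

theorem climb_of_alternating {l : List G} (hodd : ∀ g ∈ l, H.sgn g = -1) {e r : ℤ}
    (h0 : ∀ h : 0 < l.length, (0 : ℤ) < r + e * H.pos l[0])
    (h : ∀ i, ∀ hi : i + 1 < l.length, 0 < e * (-1) ^ i * (H.pos l[i] - H.pos l[i + 1])) :
    H.Climb e r l := by
  induction l generalizing e r with
  | nil => trivial
  | cons g l ih =>
    simp only [List.forall_mem_cons] at hodd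
    refine ⟨fun hg => by omega, fun _ => ⟨h0 (by simp), ih hodd.2 ?_ ?_⟩⟩
    · intro hl
      have := h 0 (by simpa using hl)
      simp only [List.getElem_cons_zero, List.getElem_cons_succ, pow_zero, zero_add] at this
      linarith
    · intro i hi
      have := h (i + 1) (by simpa using hi)
      simp only [List.getElem_cons_succ, pow_succ] at this
      linarith

theorem exists_climb_perm {O : List G} (hnd : O.Nodup) (hodd : ∀ g ∈ O, H.sgn g = -1)
    (hlen : 4 ≤ O.length) : ∃ l : List G, l.Perm O ∧ ∃ r, H.Climb 1 r l := by
  set w := O.mergeSort (fun a b => decide (H.pos a ≤ H.pos b)) with hw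
  have hwp : w.Perm O := List.mergeSort_perm _ _
  have hwl : w.length = O.length := hwp.length_eq
  have hwnd : w.Nodup := hwp.nodup_iff.2 hnd
  have hsort : w.Pairwise fun a b => H.pos a ≤ H.pos b := by
    have := List.pairwise_mergeSort (le := fun a b => decide (H.pos a ≤ H.pos b))
      (fun a b c hab hbc => by simp at *; omega) (fun a b => by simp; omega) O
    simpa using this
  have hle : ∀ i j, ∀ hij : i ≤ j, ∀ hj : j < w.length, H.pos w[i] ≤ H.pos w[j] := by
    intro i j hij hj
    rcases hij.eq_or_lt with rfl | hij
    · rfl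
    · exact List.pairwise_iff_getElem.1 hsort i j _ hj hij
  have hinj : ∀ i j, ∀ hi : i < w.length, ∀ hj : j < w.length, w[i] = w[j] → i = j :=
    fun i j hi hj h => (hwnd.getElem_inj_iff).1 h
  have hlt : ∀ i j, ∀ hij : i + 2 ≤ j, ∀ hj : j < w.length, H.pos w[i] < H.pos w[j] := by
    intro i j hij hj
    by_contra! hc
    have h1 := hle i (i + 1) (by omega) (by omega)
    have h2 := hle (i + 1) j (by omega) hj
    have hs : ∀ k, ∀ hk : k < w.length, H.sgn w[k] = -1 :=
      fun k hk => hodd _ (hwp.mem_iff.1 (List.getElem_mem hk))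
    have e1 := H.eq_or_eq w[i] w[i + 1] (by omega) (by rw [hs, hs])
    have e2 := H.eq_or_eq w[i] w[j] (by omega) (by rw [hs, hs])
    rcases e1 with e1 | e1
    · have := hinj _ _ _ _ e1
      omega
    · rcases e2 with e2 | e2
      · have := hinj _ _ _ _ e2
        omega
      · have := hinj _ _ _ _ (e1.trans e2.symm)
        omega
  let idx : ℕ → ℕ := fun i => if i % 2 = 0 then w.length / 2 + i / 2 else i / 2
  have hidx : ∀ i, i < w.length → idx i < w.length := by
    intro i hi
    simp only [idx]
    split_ifs <;> omega
  let l : List G := List.ofFn fun i : Fin w.length => w[idx i]'(hidx i i.2)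
  have hll : l.length = w.length := List.length_ofFn
  have hlnd : l.Nodup := by
    refine List.nodup_ofFn.2 fun i j hij => ?_
    have := hinj _ _ _ _ hij
    have hi := i.2
    have hj := j.2
    simp only [idx] at this
    ext
    split_ifs at this <;> omega
  have hlp : l.Perm w := by
    refine (List.subperm_of_subset hlnd ?_).perm_of_length_le hll.ge
    intro x hx
    obtain ⟨i, rfl⟩ := (List.mem_ofFn' _ _).1 hx
    exact List.getElem_mem _
  refine ⟨l, hlp.trans hwp, 1 - H.pos (l[0]'(by omega)), H.climb_of_alternating ?_ ?_ ?_⟩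
  · exact fun g hg => hodd g ((hlp.trans hwp).mem_iff.1 hg)
  · intro _
    omega
  · intro i hi
    rw [hll] at hi
    simp only [l, List.getElem_ofFn]
    rcases Nat.even_or_odd i with he | ho
    · rw [he.neg_one_pow]
      have := hlt (idx (i + 1)) (idx i)
        (by have := Nat.even_iff.1 he; simp only [idx]; split_ifs <;> omega) (hidx _ (by omega))
      omega
    · rw [ho.neg_one_pow]
      have := hlt (idx i) (idx (i + 1))
        (by have := Nat.odd_iff.1 ho; simp only [idx]; split_ifs <;> omega) (hidx _ hi)
      omega

open Classical in
theorem perm_toList_of_parts (S : Finset G) {A B C O : List G}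
    (hA : A.Perm (S.filter fun g => H.sgn g = 1 ∧ 0 < H.pos g).toList)
    (hB : B.Perm (S.filter fun g => H.sgn g = 1 ∧ H.pos g < 0).toList)
    (hC : C.Perm (S.filter fun g => H.sgn g = 1 ∧ H.pos g = 0).toList)
    (hO : O.Perm (S.filter fun g => H.sgn g = -1).toList) :
    (C ++ (A ++ (B ++ O))).Perm S.toList := by
  refine (hC.append (hA.append (hB.append hO))).trans ?_
  rw [List.perm_ext_iff_of_nodup _ S.nodup_toList]
  · intro x
    simp only [List.mem_append, Finset.mem_toList, Finset.mem_filter]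
    have := lt_trichotomy 0 (H.pos x)
    have := H.sgn_eq x
    grind
  · simp only [List.nodup_append, Finset.nodup_toList, List.mem_append, Finset.mem_toList,
      Finset.mem_filter, true_and]
    grind

open Classical in
theorem length_filter_pos_eq_zero {S : Finset G} (h1 : 1 ∉ S) :
    (S.filter fun g => H.sgn g = 1 ∧ H.pos g = 0).toList.length ≤ 1 := by
  rw [Finset.length_toList, Finset.card_le_one]
  intro a ha b hb
  rw [Finset.mem_filter] at ha hb
  have key : ∀ g ∈ S, H.sgn g = 1 → H.pos g = 0 → g = H.z := by
    intro g hg hs hp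
    rcases H.eq_or_eq 1 g (by rw [H.pos_one, hp]) (by rw [H.sgn_one, hs]) with h | h
    · exact absurd (h ▸ hg) h1
    · rw [h, one_mul]
  rw [key a ha.1 ha.2.1 ha.2.2, key b hb.1 hb.2.1 hb.2.2]

open Classical in
theorem isSequenceable_of_climb {S : Finset G} (h1 : 1 ∉ S) {o : G} {t : List G}
    (hperm : (o :: t).Perm (S.filter fun g => H.sgn g = -1).toList)
    (ht : H.Climb (-1) (H.pos o)
      ((S.filter fun g => H.sgn g = 1 ∧ H.pos g < 0).toList ++ t)) :
    IsSequenceable S := by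
  have ho : H.sgn o = -1 := by
    have : o ∈ (S.filter fun g => H.sgn g = -1).toList := hperm.mem_iff.1 (by simp)
    simp at this
    exact this.2
  set A := (S.filter fun g => H.sgn g = 1 ∧ 0 < H.pos g).toList with hA
  set B := (S.filter fun g => H.sgn g = 1 ∧ H.pos g < 0).toList with hB
  have hclimb : H.Climb 1 (1 - H.pos o) (A ++ (o :: (B ++ t))) := by
    refine Climb.append ⟨fun h => by omega, fun _ => ⟨by omega, by rwa [one_mul]⟩⟩ ?_
    intro g hg
    simp [hA] at hg
    exact ⟨hg.2.1, by omega⟩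
  refine (hclimb.blockFree_append (H.length_filter_pos_eq_zero h1) ?_).isSequenceable ?_
  · intro g hg
    simp at hg
    exact ⟨fun h => h1 (h ▸ hg.1), hg.2⟩
  · refine List.Perm.trans ?_ (H.perm_toList_of_parts S (.refl _) (.refl _) (.refl _) hperm)
    exact (List.perm_middle.symm.append_left _).append_left _

open Classical in
theorem isSequenceable_of_alternating {S : Finset G} (h1 : 1 ∉ S) {l : List G} {r : ℤ}
    (hperm : l.Perm (S.filter fun g => H.sgn g = -1).toList) (hl : l ≠ [])
    (hclimb : H.Climb 1 r l) : IsSequenceable S := by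
  obtain ⟨o, t, rfl⟩ := List.exists_cons_of_ne_nil hl
  have ho : H.sgn o = -1 := by
    have : o ∈ (S.filter fun g => H.sgn g = -1).toList := hperm.mem_iff.1 (by simp)
    simp at this
    exact this.2
  refine H.isSequenceable_of_climb h1 hperm (Climb.append ?_ ?_)
  · simpa using (hclimb.2 ho).2
  · intro g hg
    simp at hg
    exact ⟨hg.2.1, by omega⟩

theorem isSequenceable_of_even {S : Finset G} (h1 : 1 ∉ S) (hS : ∀ g ∈ S, H.sgn g = 1) :
    IsSequenceable S := by
  classical
  let N : Subgroup G :=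
    { carrier := {g | H.sgn g = 1}
      one_mem' := H.sgn_one
      mul_mem' := fun {a b} ha hb => by
        simp only [Set.mem_ofPred_eq] at *
        rw [H.sgn_mul, ha, hb, one_mul]
      inv_mem' := fun {a} ha => by
        simp only [Set.mem_ofPred_eq] at *
        have := H.sgn_mul a a⁻¹
        rw [mul_inv_cancel, H.sgn_one, ha] at this
        omega }
  let : CommGroup N :=
    { (inferInstance : Group N) with
      mul_comm := fun a b => Subtype.ext (H.comm a b a.2 b.2) }
  have hseq : IsSequenceable (S.subtype (· ∈ N)) := by
    refine isSequenceable_of_pos (fun g : N => H.pos g) ?_ ?_ ?_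
    · intro g h
      have hg : H.sgn g = 1 := g.2
      have := H.pos_mul g h
      rw [hg, one_mul] at this
      exact this
    · simpa using h1
    · intro g hg h hh hg0 hh0
      rw [Finset.mem_subtype] at hg hh
      have := Finset.card_le_one.1 ((Finset.length_toList _).symm.trans_le
        (H.length_filter_pos_eq_zero h1)) g (by simpa using ⟨hg, g.2, hg0⟩) h
        (by simpa using ⟨hh, h.2, hh0⟩)
      exact Subtype.ext this
  have := hseq.map N.subtype N.subtype_injective
  convert this using 1
  ext x
  simp only [Finset.mem_map, Finset.mem_subtype, Function.Embedding.coeFn_mk]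
  exact ⟨fun hx => ⟨⟨x, hS x hx⟩, hx, rfl⟩, by rintro ⟨y, hy, rfl⟩; exact hy⟩

theorem blockFree_of_odd_ends {a b : G} {C : List G} (ha : H.sgn a = -1) (hb : H.sgn b = -1)
    (hC : C.length ≤ 1) (hC1 : ∀ g ∈ C, H.sgn g = 1 ∧ g ≠ 1) : BlockFree (a :: (C ++ [b])) := by
  intro u v w huvw hv huw hprod
  have hs : H.sgn v.prod = 1 := by rw [hprod, H.sgn_one]
  rcases C with _ | ⟨c, _ | ⟨c', C⟩⟩
  · clear hprod hC1
    rcases u with _ | ⟨u1, _ | ⟨u2, _ | ⟨u3, u⟩⟩⟩ <;>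
    rcases v with _ | ⟨v1, _ | ⟨v2, _ | ⟨v3, v⟩⟩⟩ <;>
    simp_all
  · have hvc : v ≠ [c] := by
      rintro rfl
      exact (hC1 c (by simp)).2 (by simpa using hprod)
    have hcs := (hC1 c (by simp)).1
    clear hprod hC1 hC
    rcases u with _ | ⟨u1, _ | ⟨u2, _ | ⟨u3, _ | ⟨u4, u⟩⟩⟩⟩ <;>
    rcases v with _ | ⟨v1, _ | ⟨v2, _ | ⟨v3, _ | ⟨v4, v⟩⟩⟩⟩ <;>
    simp_all [H.sgn_mul]
  · simp at hC

theorem isSequenceable_of_pair {S : Finset G} (h1 : 1 ∉ S) {a b : G} (ha : H.sgn a = -1)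
    (hb : H.sgn b = -1) (hab : H.pos a = H.pos b) (hne : a ≠ b)
    (hS : ∀ g, (g ∈ S ∧ H.sgn g = -1) ↔ g = a ∨ g = b) : IsSequenceable S := by
  classical
  have key : ∀ H' : TwistedHeight G, H'.sgn = H.sgn → H'.pos a = H'.pos b →
      (∃ g ∈ S, H'.sgn g = 1 ∧ H'.pos g < 0) → IsSequenceable S := by
    rintro H' hs hp ⟨g, hg⟩
    refine H'.isSequenceable_of_climb h1 (o := a) (t := [b]) ?_ ?_
    · rw [List.perm_ext_iff_of_nodup (by simpa using hne) (Finset.nodup_toList _)]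
      intro x
      simp [hs, hS]
    · have hg' : g ∈ (S.filter fun g => H'.sgn g = 1 ∧ H'.pos g < 0).toList := by simpa using hg
      have hall : ∀ g ∈ (S.filter fun g => H'.sgn g = 1 ∧ H'.pos g < 0).toList,
          H'.sgn g = 1 ∧ H'.pos g < 0 := by
        intro g hg
        simp at hg
        exact hg.2
      generalize (S.filter fun g => H'.sgn g = 1 ∧ H'.pos g < 0).toList = B at hg' hall
      rcases B with _ | ⟨c, B⟩
      · simp at hg'
      · simp only [List.forall_mem_cons] at hall
        refine ⟨fun _ => ⟨by omega, Climb.append ?_ ?_⟩, fun h => by omega⟩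
        · refine ⟨fun h => ?_, fun _ => ⟨by omega, trivial⟩⟩
          rw [hs] at h
          omega
        · intro g hg
          have := hall.2 g hg
          exact ⟨this.1, by omega⟩
  by_cases hneg : ∃ g ∈ S, H.sgn g = 1 ∧ H.pos g < 0
  · exact key H rfl hab hneg
  by_cases hpos : ∃ g ∈ S, H.sgn g = 1 ∧ 0 < H.pos g
  · refine key H.neg rfl (by simp [neg, hab]) ?_
    simpa [neg] using hpos
  have hlen := H.length_filter_pos_eq_zero h1
  have hmem : ∀ g ∈ (S.filter fun g => H.sgn g = 1 ∧ H.pos g = 0).toList,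
      H.sgn g = 1 ∧ g ≠ 1 := by
    intro g hg
    simp at hg
    exact ⟨hg.2.1, fun h => h1 (h ▸ hg.1)⟩
  have hperm := H.perm_toList_of_parts S (A := []) (B := []) (O := [a, b])
    (by
      rw [Finset.filter_eq_empty_iff.2 fun x hx h => hpos ⟨x, hx, h⟩]
      simp)
    (by
      rw [Finset.filter_eq_empty_iff.2 fun x hx h => hneg ⟨x, hx, h⟩]
      simp) (.refl _)
    (by
      rw [List.perm_ext_iff_of_nodup (by simpa using hne) (Finset.nodup_toList _)]
      intro x
      simp [hS])
  generalize (S.filter fun g => H.sgn g = 1 ∧ H.pos g = 0).toList = C at hlen hmem hperm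
  have hbf := H.blockFree_of_odd_ends ha hb hlen hmem
  refine hbf.isSequenceable (List.Perm.trans ?_ hperm)
  simpa using (List.perm_middle (a := a) (l₁ := C) (l₂ := [b])).symm

theorem stronglySequenceable (H : TwistedHeight G) : StronglySequenceable G := by
  classical
  intro S h1
  have hodd : ∀ g ∈ (S.filter fun g => H.sgn g = -1).toList, H.sgn g = -1 := by simp
  have hnd : (S.filter fun g => H.sgn g = -1).toList.Nodup := Finset.nodup_toList _
  have hmem : ∀ g, g ∈ (S.filter fun g => H.sgn g = -1).toList ↔ g ∈ S ∧ H.sgn g = -1 := by simp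
  have hup := fun l r => H.isSequenceable_of_alternating h1 (l := l) (r := r)
  have hdown : ∀ (l : List G) (r : ℤ), l.Perm (S.filter fun g => H.sgn g = -1).toList → l ≠ [] →
      H.neg.Climb 1 r l → IsSequenceable S :=
    fun l r => H.neg.isSequenceable_of_alternating h1
  generalize (S.filter fun g => H.sgn g = -1).toList = O at hodd hnd hmem hup hdown
  rcases O with _ | ⟨a, _ | ⟨b, _ | ⟨c, _ | ⟨d, O⟩⟩⟩⟩
  · refine H.isSequenceable_of_even h1 fun g hg => (H.sgn_eq g).resolve_right fun h => ?_
    simpa using (hmem g).2 ⟨hg, h⟩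
  · refine hup [a] (1 - H.pos a) (.refl _) (by simp) ?_
    simp [Climb, hodd a]
  · simp only [List.forall_mem_cons] at hodd
    obtain ⟨ha, hb, -⟩ := hodd
    rcases lt_trichotomy (H.pos a) (H.pos b) with h | h | h
    · refine hup [b, a] (1 - H.pos b) (.swap _ _ _) (by simp) ?_
      simp [Climb, ha, hb, h]
    · refine H.isSequenceable_of_pair h1 ha hb h (by simpa using hnd) fun g => ?_
      rw [← hmem]
      simp
    · refine hup [a, b] (1 - H.pos a) (.refl _) (by simp) ?_
      simp [Climb, ha, hb, h]
  · simp only [List.forall_mem_cons] at hodd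
    obtain ⟨ha, hb, hc, -⟩ := hodd
    have hvalley : ∀ x y z, [x, y, z].Perm [a, b, c] → H.pos y < H.pos x → H.pos y < H.pos z →
        IsSequenceable S := by
      intro x y z hp hx hz
      have hs : ∀ g ∈ [x, y, z], H.sgn g = -1 := fun g hg => by
        have := hp.mem_iff.1 hg
        simp at this
        rcases this with rfl | rfl | rfl <;> assumption
      simp only [List.forall_mem_cons] at hs
      refine hup [x, y, z] (1 - H.pos x) hp (by simp) ?_
      simp [Climb, hs, hx, hz]
    have hpeak : ∀ x y z, [x, y, z].Perm [a, b, c] → H.pos x < H.pos y → H.pos z < H.pos y →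
        IsSequenceable S := by
      intro x y z hp hx hz
      have hs : ∀ g ∈ [x, y, z], H.neg.sgn g = -1 := fun g hg => by
        have := hp.mem_iff.1 hg
        simp at this
        rcases this with rfl | rfl | rfl <;> assumption
      simp only [List.forall_mem_cons] at hs
      refine hdown [x, y, z] (1 - H.neg.pos x) hp (by simp) ?_
      simp [Climb, hs]
      simp [neg, hx, hz]
    have hpb : [b, a, c].Perm [a, b, c] := .swap _ _ _
    have hpc : [a, c, b].Perm [a, b, c] := (List.Perm.swap _ _ _).cons a
    have hnot : ¬(H.pos a = H.pos b ∧ H.pos a = H.pos c) := by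
      rintro ⟨h, h'⟩
      have e1 := H.eq_or_eq a b h (by rw [ha, hb])
      have e2 := H.eq_or_eq a c h' (by rw [ha, hc])
      simp only [List.nodup_cons, List.mem_cons] at hnd
      grind
    have v1 := hvalley b a c hpb
    have v2 := hvalley a b c (.refl _)
    have v3 := hvalley a c b hpc
    have p1 := hpeak b a c hpb
    have p2 := hpeak a b c (.refl _)
    have p3 := hpeak a c b hpc
    by_contra hcon
    simp only [hcon] at v1 v2 v3 p1 p2 p3
    grind
  · obtain ⟨l, hl, r, hr⟩ := H.exists_climb_perm hnd hodd (by simp)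
    refine hup l r hl ?_ hr
    rintro rfl
    simpa using hl.length_eq

end TwistedHeight

/-- The sign character of `ℤ₄` with kernel `{0, 2}`. -/
def zmodFourSign (h : ZMod 4) : ℤ := if h = 0 ∨ h = 2 then 1 else -1

theorem toAdd_apply_eq_zmodFourSign_mul
    (φ : Multiplicative (ZMod 4) →* MulAut (Multiplicative ℤ))
    (hφ : ∀ x : Multiplicative ℤ, φ (Multiplicative.ofAdd 1) x = x⁻¹)
    (h : Multiplicative (ZMod 4)) (x : Multiplicative ℤ) :
    (φ h x).toAdd = zmodFourSign h.toAdd * x.toAdd := by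
  have h2 : ∀ x, φ (Multiplicative.ofAdd 2) x = x := fun x => by
    rw [show (Multiplicative.ofAdd (2 : ZMod 4)) = .ofAdd 1 * .ofAdd 1 from rfl, map_mul,
      MulAut.mul_apply, hφ, hφ, inv_inv]
  have h3 : ∀ x, φ (Multiplicative.ofAdd 3) x = x⁻¹ := fun x => by
    rw [show (Multiplicative.ofAdd (3 : ZMod 4)) = .ofAdd 2 * .ofAdd 1 from rfl, map_mul,
      MulAut.mul_apply, hφ, h2]
  have hcases : ∀ k : ZMod 4, k = 0 ∨ k = 1 ∨ k = 2 ∨ k = 3 := by decide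
  obtain ⟨k, rfl⟩ := Multiplicative.ofAdd.surjective h
  rcases hcases k with rfl | rfl | rfl | rfl
  · simp [zmodFourSign]
  · rw [hφ, toAdd_ofAdd, show zmodFourSign 1 = -1 by decide]
    simp
  · rw [h2, toAdd_ofAdd, show zmodFourSign 2 = 1 by decide]
    simp
  · rw [h3, toAdd_ofAdd, show zmodFourSign 3 = -1 by decide]
    simp

/-- The semidirect product `ℤ ⋊_φ ℤ₄`, where `φ(1)` is negation, is strongly
sequenceable. -/
theorem semidirect_int_zmod4_strongly_sequenceable
    (φ : Multiplicative (ZMod 4) →* MulAut (Multiplicative ℤ))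
    (hφ : ∀ x : Multiplicative ℤ, φ (Multiplicative.ofAdd 1) x = x⁻¹) :
    StronglySequenceable (SemidirectProduct (Multiplicative ℤ) (Multiplicative (ZMod 4)) φ) := by
  have hact := toAdd_apply_eq_zmodFourSign_mul φ hφ
  refine TwistedHeight.stronglySequenceable
    { pos := fun g => g.left.toAdd
      sgn := fun g => zmodFourSign g.right.toAdd
      z := ⟨1, Multiplicative.ofAdd 2⟩
      sgn_mul := ?_
      sgn_eq := ?_
      pos_mul := ?_
      eq_or_eq := ?_
      comm := ?_ }
  · intro g h
    have : ∀ a b : ZMod 4, zmodFourSign (a + b) = zmodFourSign a * zmodFourSign b := by decide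
    exact this _ _
  · intro g
    have : ∀ a : ZMod 4, zmodFourSign a = 1 ∨ zmodFourSign a = -1 := by decide
    exact this _
  · intro g h
    simp [hact]
  · intro g h hp hs
    have key : ∀ a b : ZMod 4, zmodFourSign a = zmodFourSign b → b = a ∨ b = a + 2 := by decide
    refine (key _ _ hs).imp (fun hr => ?_) (fun hr => ?_)
    · exact SemidirectProduct.ext (Multiplicative.toAdd.injective hp.symm)
        (Multiplicative.toAdd.injective hr)
    · refine SemidirectProduct.ext ?_ (Multiplicative.toAdd.injective hr)
      simpa using hp.symm
  · intro g h hg hh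
    refine SemidirectProduct.ext (Multiplicative.toAdd.injective ?_) ?_
    · simp only [SemidirectProduct.mul_left, toAdd_mul, hact, hg, hh]
      ring
    · simp only [SemidirectProduct.mul_right, mul_comm]
end

section
/- Let G and G' be groups, let S be a finite subset of G \ {0} of size k and S' a finite subset of G' \ {0} of size k, and suppose S is weakly Freiman isomorphic of order k to S'. If S' is sequenceable, then S is sequenceable. -/
/-- `f` is a weak Freiman homomorphism of order `k` from `S` (in the ambient group `V`)
to `S'` (in the ambient group `W`). -/
def IsWeakFreimanHom {V W : Type*} [Group V] [Group W] (k : ℕ)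
    (S : Finset V) (S' : Finset W) (f : V → W) : Prop :=
  (∀ x ∈ S, f x ∈ S') ∧
    ∀ l : List V, l.Nodup → (∀ x ∈ l, x ∈ S) → l.length ≤ k →
      l.prod = 1 → (l.map f).prod = 1

/-- `f` is a weak Freiman isomorphism of order `k` from `S` to `S'`. -/
def IsWeakFreimanIso {V W : Type*} [Group V] [Group W] (k : ℕ)
    (S : Finset V) (S' : Finset W) (f : V → W) : Prop :=
  Set.BijOn f ↑S ↑S' ∧ IsWeakFreimanHom k S S' f ∧
    ∃ g : W → V, (∀ x ∈ S, g (f x) = x) ∧ (∀ y ∈ S', f (g y) = y) ∧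
      IsWeakFreimanHom k S' S g

/-- Two prefix products of a list agree iff the segment between them has product `1`. -/
theorem List.prod_take_eq_prod_take_iff {G : Type*} [Group G] (l : List G) {i j : ℕ}
    (hij : i ≤ j) : (l.take i).prod = (l.take j).prod ↔ ((l.take j).drop i).prod = 1 := by
  have h := List.prod_take_mul_prod_drop (l.take j) i
  rw [List.take_take, min_eq_left hij] at h
  rw [← h, left_eq_mul]

/-- If `S` (of size `k`, avoiding the identity) is weakly Freiman isomorphic of order
`k` to `S'` (of size `k`, avoiding the identity) and `S'` is sequenceable, then `S` is
sequenceable. -/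
theorem sequenceable_of_weak_freiman_iso {G G' : Type*} [Group G] [Group G'] (k : ℕ)
    (S : Finset G) (S' : Finset G') (hS : S.card = k) (hS' : S'.card = k)
    (h1 : (1 : G) ∉ S) (h1' : (1 : G') ∉ S')
    (f : G → G') (hf : IsWeakFreimanIso k S S' f)
    (hseq : IsSequenceable S') : IsSequenceable S := by
  obtain ⟨-, ⟨hfS, hf_hom⟩, g, hgf, hfg, hgS, -⟩ := hf
  obtain ⟨l, hnd, hmem, hprod⟩ := hseq
  have hnd_map : (l.map g).Nodup := hnd.map_on fun x hx y hy hxy => by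
    rw [← hfg x ((hmem x).1 hx), ← hfg y ((hmem y).1 hy), hxy]
  have hmem_map : ∀ x, x ∈ l.map g ↔ x ∈ S := fun x => by
    rw [List.mem_map]
    exact ⟨fun ⟨y, hy, hyx⟩ => hyx ▸ hgS y ((hmem y).1 hy),
      fun hx => ⟨f x, (hmem _).2 (hfS x hx), hgf x hx⟩⟩
  have hmap_map : (l.map g).map f = l := by
    rw [List.map_map]
    exact (List.map_congr_left fun y hy => hfg y ((hmem y).1 hy)).trans (List.map_id l)
  have hlen : (l.map g).length = k := by
    classical
    rw [← hS, ← List.toFinset_card_of_nodup hnd_map]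
    congr 1
    ext x
    rw [List.mem_toFinset, hmem_map]
  refine ⟨l.map g, hnd_map, hmem_map, fun i j hij hj hne heq => ?_⟩
  rw [List.length_map] at hj hne
  refine hprod i j hij hj hne ((List.prod_take_eq_prod_take_iff l hij.le).2 ?_)
  have hsub : (((l.map g).take j).drop i).Sublist (l.map g) :=
    (List.drop_sublist _ _).trans (List.take_sublist _ _)
  have hone := hf_hom _ (hnd_map.sublist hsub) (fun x hx => (hmem_map x).1 (hsub.subset hx))
    (hlen ▸ hsub.length_le) ((List.prod_take_eq_prod_take_iff _ hij.le).1 heq)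
  rwa [List.map_drop, List.map_take, hmap_map] at hone
end
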